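/- (Main counter-bound lemma.) There exists a polynomial P₃ with P₃(K) = P₁(K) + 2·((K²·P₂(K))² + 1) (so P₃(K) = O(K¹²)), such that every counter value appearing in any configuration pair of the run ρ_min of a minimal witness distinguishing two non-equivalent dwROCAs A₁ and A₂ is bounded by P₃(K). -/

import Mathlib

/-- A deterministic weighted real-time one-counter automaton (dwROCA) over
alphabet `A` and field `S`.  `next q b a`, `upd q b a`, `wt q b a` give the
target state, counter update and (nonzero) weight of the unique transition
from state `q` reading letter `a` with counter-status `b` (`true` = counter is
zero). -/
structure DWROCA (A : Type) (S : Type) [Field S] where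
  Q : Type
  fin : Fintype Q
  q0 : Q
  s0 : S
  s0_ne : s0 ≠ 0
  next : Q → Bool → A → Q
  upd : Q → Bool → A → ℤ
  wt : Q → Bool → A → S
  upd_mem : ∀ q b a, upd q b a ∈ ({-1, 0, 1} : Set ℤ)
  no_dec_on_zero : ∀ q a, upd q true a ≠ -1
  wt_ne : ∀ q b a, wt q b a ≠ 0

attribute [instance] DWROCA.fin

/-- Configurations: a state, a counter value and a weight. -/
abbrev DWROCA.Cfg {A S : Type} [Field S] (M : DWROCA A S) : Type := M.Q × ℕ × S

variable {A S : Type} [Field S]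

/-- One step of a dwROCA on a configuration. -/
def DWROCA.step (M : DWROCA A S) (c : M.Cfg) (x : A) : M.Cfg :=
  (M.next c.1 (decide (c.2.1 = 0)) x,
   ((c.2.1 : ℤ) + M.upd c.1 (decide (c.2.1 = 0)) x).toNat,
   c.2.2 * M.wt c.1 (decide (c.2.1 = 0)) x)

/-- The run of a dwROCA on a word from a configuration. -/
def DWROCA.run (M : DWROCA A S) (c : M.Cfg) (w : List A) : M.Cfg :=
  w.foldl M.step c

/-- `f(w, c)`: the value assigned to the word `w` by the configuration `c`. -/
def DWROCA.val (M : DWROCA A S) (c : M.Cfg) (w : List A) : S :=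
  (M.run c w).2.2

/-- The initial configuration. -/
def DWROCA.init (M : DWROCA A S) : M.Cfg := (M.q0, 0, M.s0)

/-- The function `f_A : Σ* → S` computed by a dwROCA. -/
def DWROCA.f (M : DWROCA A S) (w : List A) : S := M.val M.init w

/-- One step of the underlying uninitialised weighted automaton `uwa(M)`:
the counter is ignored (nonzero tests are always taken).  Its configurations
are pairs (state, weight). -/
def DWROCA.ustep (M : DWROCA A S) (c : M.Q × S) (x : A) : M.Q × S :=
  (M.next c.1 false x, c.2 * M.wt c.1 false x)

/-- The value assigned to a word by a configuration of `uwa(M)`. -/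
def DWROCA.uval (M : DWROCA A S) (c : M.Q × S) (w : List A) : S :=
  (w.foldl M.ustep c).2

/-- `k`-equivalence of configurations of two dwROCAs. -/
def kEquiv (M N : DWROCA A S) (c : M.Cfg) (d : N.Cfg) (k : ℕ) : Prop :=
  ∀ w : List A, w.length ≤ k → M.val c w = N.val d w

/-- `k`-equivalence of a configuration of `M` with a configuration of the
underlying weighted automaton `uwa(N)`. -/
def kEquivU (M N : DWROCA A S) (c : M.Cfg) (d : N.Q × S) (k : ℕ) : Prop :=
  ∀ w : List A, w.length ≤ k → M.val c w = N.uval d w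

/-- Membership in `NWA` (relative to the pair `A₁`, `A₂`): a configuration of
`M` (where `M` is `A₁` or `A₂`) not `K`-equivalent to any configuration of
`uwa(A₁) ∪ uwa(A₂)`. -/
def inNWA (A₁ A₂ M : DWROCA A S) (c : M.Cfg) (K : ℕ) : Prop :=
  (∀ d : A₁.Q × S, ¬ kEquivU M A₁ c d K) ∧ (∀ d : A₂.Q × S, ¬ kEquivU M A₂ c d K)

/-- `dist(c)`: least length of a word taking `c` into `NWA` (`⊤` if none). -/
noncomputable def distNWA (A₁ A₂ M : DWROCA A S) (c : M.Cfg) (K : ℕ) : ℕ∞ :=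
  sInf {n : ℕ∞ | ∃ w : List A, (w.length : ℕ∞) = n ∧ inNWA A₁ A₂ M (M.run c w) K}

/-- A configuration pair is surely-equivalent if the two configurations are
`K`-equivalent and both have infinite distance to `NWA`. -/
def surelyEq (A₁ A₂ : DWROCA A S) (c : A₁.Cfg) (d : A₂.Cfg) (K : ℕ) : Prop :=
  kEquiv A₁ A₂ c d K ∧ distNWA A₁ A₂ A₁ c K = ⊤ ∧ distNWA A₁ A₂ A₂ d K = ⊤

/-- A configuration pair is surely-nonequivalent if the two configurations are
not `K`-equivalent or have different distances to `NWA`. -/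
def surelyNonEq (A₁ A₂ : DWROCA A S) (c : A₁.Cfg) (d : A₂.Cfg) (K : ℕ) : Prop :=
  ¬ kEquiv A₁ A₂ c d K ∨ distNWA A₁ A₂ A₁ c K ≠ distNWA A₁ A₂ A₂ d K

/-- A configuration pair is unresolved if the configurations are `K`-equivalent
and have equal finite distances to `NWA`. -/
def unresolved (A₁ A₂ : DWROCA A S) (c : A₁.Cfg) (d : A₂.Cfg) (K : ℕ) : Prop :=
  kEquiv A₁ A₂ c d K ∧ distNWA A₁ A₂ A₁ c K = distNWA A₁ A₂ A₂ d K ∧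
    distNWA A₁ A₂ A₁ c K ≠ ⊤

/-- `w` is a minimal-length witness distinguishing `A₁` and `A₂`. -/
def IsMinWitness (A₁ A₂ : DWROCA A S) (w : List A) : Prop :=
  A₁.f w ≠ A₂.f w ∧ ∀ v : List A, A₁.f v ≠ A₂.f v → w.length ≤ v.length

/-- The `i`-th configuration pair `c_i` of the run of `w` from the initial
configuration pair. -/
def pairAt (A₁ A₂ : DWROCA A S) (w : List A) (i : ℕ) : A₁.Cfg × A₂.Cfg :=
  (A₁.run A₁.init (w.take i), A₂.run A₂.init (w.take i))

/-- Applying a sequence of transition pairs (determined, by determinism, by a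
word) to a configuration pair. -/
def runPair (A₁ A₂ : DWROCA A S) (c : A₁.Cfg × A₂.Cfg) (w : List A) :
    A₁.Cfg × A₂.Cfg :=
  (A₁.run c.1 w, A₂.run c.2 w)

/-- A configuration pair lies in the belt of slope `α/β` and thickness `d`. -/
def inBelt (α β d : ℕ) {A₁ A₂ : DWROCA A S} (c : A₁.Cfg × A₂.Cfg) : Prop :=
  |(α : ℤ) * (c.1.2.1 : ℤ) - (β : ℤ) * (c.2.2.1 : ℤ)| ≤ (d : ℤ)

/-- Two configuration pairs are `(α/β)`-related: same state pairs and same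
value of `α·m - β·n`. -/
def abRelated (α β : ℕ) {A₁ A₂ : DWROCA A S} (c c' : A₁.Cfg × A₂.Cfg) : Prop :=
  c.1.1 = c'.1.1 ∧ c.2.1 = c'.2.1 ∧
    (α : ℤ) * (c.1.2.1 : ℤ) - (β : ℤ) * (c.2.2.1 : ℤ) =
      (α : ℤ) * (c'.1.2.1 : ℤ) - (β : ℤ) * (c'.2.2.1 : ℤ)

namespace DWROCA

/-! ### Unweighted configurations and bounded equivalence -/

/-- One step on a configuration without its weight. -/
def cstep (M : DWROCA A S) (c : M.Q × ℕ) (x : A) : M.Q × ℕ :=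
  (M.next c.1 (decide (c.2 = 0)) x, ((c.2 : ℤ) + M.upd c.1 (decide (c.2 = 0)) x).toNat)

/-- The run on a word from a configuration without its weight. -/
def crun (M : DWROCA A S) (c : M.Q × ℕ) (w : List A) : M.Q × ℕ :=
  w.foldl M.cstep c

/-- The common state space of the configurations of `M` and of `uwa(M)`. -/
abbrev Point (M : DWROCA A S) : Type := (M.Q × ℕ) ⊕ M.Q

/-- The transition function on points. -/
def pstep (M : DWROCA A S) : M.Point → A → M.Point
  | .inl c, x => .inl (M.cstep c x)
  | .inr q, x => .inr (M.next q false x)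

/-- The weight of the transition taken at a point. -/
def pout (M : DWROCA A S) : M.Point → A → S
  | .inl c, x => M.wt c.1 (decide (c.2 = 0)) x
  | .inr q, x => M.wt q false x

/-- `k`-equivalence of points: the transition weights agree along all words of length at most
`k`. -/
def Eqv (M : DWROCA A S) : ℕ → M.Point → M.Point → Prop
  | 0, _, _ => True
  | k + 1, a, b => ∀ x, M.pout a x = M.pout b x ∧ Eqv M k (M.pstep a x) (M.pstep b x)

variable {M : DWROCA A S}

theorem Eqv.refl (k : ℕ) (a : M.Point) : M.Eqv k a a := by
  induction k generalizing a with
  | zero => trivial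
  | succ k ih => exact fun x => ⟨rfl, ih _⟩

theorem Eqv.symm {k : ℕ} {a b : M.Point} (h : M.Eqv k a b) : M.Eqv k b a := by
  induction k generalizing a b with
  | zero => trivial
  | succ k ih => exact fun x => ⟨(h x).1.symm, ih (h x).2⟩

theorem Eqv.trans {k : ℕ} {a b c : M.Point} (h : M.Eqv k a b) (h' : M.Eqv k b c) :
    M.Eqv k a c := by
  induction k generalizing a b c with
  | zero => trivial
  | succ k ih => exact fun x => ⟨(h x).1.trans (h' x).1, ih (h x).2 (h' x).2⟩

theorem Eqv.pred {k : ℕ} {a b : M.Point} (h : M.Eqv (k + 1) a b) : M.Eqv k a b := by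
  induction k generalizing a b with
  | zero => trivial
  | succ k ih => exact fun x => ⟨(h x).1, ih (h x).2⟩

theorem Eqv.mono {k l : ℕ} {a b : M.Point} (h : M.Eqv k a b) (hl : l ≤ k) : M.Eqv l a b := by
  induction k, hl using Nat.le_induction with
  | base => exact h
  | succ k _ ih => exact ih h.pred

/-- `k`-equivalence on the states of `uwa(M)`. -/
def eqvSetoid (M : DWROCA A S) (k : ℕ) : Setoid M.Q where
  r p q := M.Eqv k (.inr p) (.inr q)
  iseqv := ⟨fun _ => Eqv.refl _ _, fun h => h.symm, fun h h' => h.trans h'⟩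

theorem eqv_stable_of_eqv_succ {k : ℕ}
    (hk : ∀ p q : M.Q, M.Eqv k (.inr p) (.inr q) → M.Eqv (k + 1) (.inr p) (.inr q))
    {p q : M.Q} (h : M.Eqv k (.inr p) (.inr q)) (j : ℕ) : M.Eqv j (.inr p) (.inr q) := by
  induction j generalizing p q with
  | zero => trivial
  | succ j ih => exact fun x => ⟨(hk p q h x).1, ih (hk p q h x).2⟩

theorem exists_eqv_stable {K : ℕ} (hK : Fintype.card M.Q ≤ K) :
    ∃ k < K, ∀ p q : M.Q, M.Eqv k (.inr p) (.inr q) → M.Eqv (k + 1) (.inr p) (.inr q) := by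
  classical
  by_contra! hcon
  have key : ∀ k ≤ K, k + 1 ≤ Nat.card (Quotient (M.eqvSetoid k)) := by
    intro k
    induction k with
    | zero =>
      intro _
      have : Nonempty (Quotient (M.eqvSetoid 0)) := ⟨Quotient.mk _ M.q0⟩
      exact Nat.card_pos
    | succ k ih =>
      intro hk
      obtain ⟨p, q, hpq, hne⟩ := hcon k (by omega)
      let f : Quotient (M.eqvSetoid (k + 1)) → Quotient (M.eqvSetoid k) :=
        Quotient.map id (fun _ _ h => Eqv.pred h)
      have hf : Function.Surjective f := by
        rintro ⟨a⟩
        exact ⟨Quotient.mk _ a, rfl⟩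
      have hle := Nat.card_le_card_of_surjective f hf
      have hlt : Nat.card (Quotient (M.eqvSetoid k)) ≠
          Nat.card (Quotient (M.eqvSetoid (k + 1))) := by
        intro he
        have hb := (Nat.bijective_iff_surjective_and_card f).2 ⟨hf, he.symm⟩
        have : (Quotient.mk (M.eqvSetoid (k + 1)) p) = Quotient.mk _ q :=
          hb.1 (Quotient.sound hpq)
        exact hne (Quotient.exact this)
      have := ih (by omega)
      omega
  have h1 := key K le_rfl
  have h2 : Nat.card (Quotient (M.eqvSetoid K)) ≤ Nat.card M.Q :=
    Nat.card_le_card_of_surjective (Quotient.mk _) Quotient.mk_surjective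
  rw [Nat.card_eq_fintype_card (α := M.Q)] at h2
  omega

/-- On the states of `uwa(M)`, `K`-equivalence is equivalence. -/
theorem Eqv.of_card_le {K : ℕ} (hK : Fintype.card M.Q ≤ K) {p q : M.Q}
    (h : M.Eqv K (.inr p) (.inr q)) (j : ℕ) : M.Eqv j (.inr p) (.inr q) := by
  obtain ⟨k, hk, hs⟩ := exists_eqv_stable hK
  exact eqv_stable_of_eqv_succ hs (h.mono hk.le) j

theorem upd_bounds (q : M.Q) (b : Bool) (x : A) : -1 ≤ M.upd q b x ∧ M.upd q b x ≤ 1 := by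
  have := M.upd_mem q b x
  simp only [Set.mem_insert_iff, Set.mem_singleton_iff] at this
  omega

theorem cstep_snd_bounds (c : M.Q × ℕ) (x : A) :
    (M.cstep c x).2 ≤ c.2 + 1 ∧ c.2 ≤ (M.cstep c x).2 + 1 := by
  have := upd_bounds (M := M) c.1 (decide (c.2 = 0)) x
  simp only [cstep]
  omega

/-- A configuration behaves like its state in `uwa(M)` until its counter can be zero. -/
theorem eqv_state {k : ℕ} {c : M.Q × ℕ} (h : k ≤ c.2) : M.Eqv k (.inl c) (.inr c.1) := by
  induction k generalizing c with
  | zero => trivial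
  | succ k ih =>
    intro x
    have h0 : decide (c.2 = 0) = false := by simp; omega
    have h1 := (cstep_snd_bounds c x).2
    refine ⟨by simp [pout, h0], ?_⟩
    have h2 := ih (c := M.cstep c x) (by omega)
    simpa [pstep, cstep, h0] using h2

end DWROCA

/-! ### Integer sequences with steps of size at most one -/

theorem exists_first_descent {f : ℕ → ℕ} (hf : ∀ i, f (i + 1) ≤ f i + 1 ∧ f i ≤ f (i + 1) + 1)
    {k e j : ℕ} (hke : k ≤ e) (hj : f e ≤ j) (hj' : j ≤ f k) :
    ∃ v, k ≤ v ∧ v ≤ e ∧ f v = j ∧ ∀ l, k ≤ l → l < v → j < f l := by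
  classical
  have hex : ∃ v, k ≤ v ∧ f v ≤ j := ⟨e, hke, hj⟩
  obtain ⟨h1, h2⟩ := Nat.find_spec hex
  have hmin : ∀ l, k ≤ l → l < Nat.find hex → j < f l := fun l hl hlt => by
    by_contra hle
    exact Nat.find_min hex hlt ⟨hl, by omega⟩
  refine ⟨Nat.find hex, h1, Nat.find_min' hex ⟨hke, hj⟩, ?_, hmin⟩
  rcases h1.eq_or_lt with h | h
  · rw [← h] at h2 ⊢
    omega
  · have h3 := hmin (Nat.find hex - 1) (by omega) (by omega)
    have h4 := (hf (Nat.find hex - 1)).2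
    rw [Nat.sub_add_cancel (by omega)] at h4
    omega

theorem exists_last_ascent {f : ℕ → ℕ} (hf : ∀ i, f (i + 1) ≤ f i + 1 ∧ f i ≤ f (i + 1) + 1)
    {a k j : ℕ} (hak : a ≤ k) (hj : f a ≤ j) (hj' : j ≤ f k) :
    ∃ u, a ≤ u ∧ u ≤ k ∧ f u = j ∧ ∀ l, u < l → l ≤ k → j < f l := by
  have hg : ∀ i, f (k - (i + 1)) ≤ f (k - i) + 1 ∧ f (k - i) ≤ f (k - (i + 1)) + 1 := by
    intro i
    rcases Nat.lt_or_ge i k with h | h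
    · have := hf (k - (i + 1))
      rw [show k - (i + 1) + 1 = k - i by omega] at this
      omega
    · rw [show k - (i + 1) = 0 by omega, show k - i = 0 by omega]
      omega
  obtain ⟨v, _, h2, h3, h4⟩ := exists_first_descent (f := fun i => f (k - i)) hg
    (k := 0) (e := k - a) (j := j) (Nat.zero_le _)
    (by simpa [Nat.sub_sub_self hak] using hj) (by simpa using hj')
  refine ⟨k - v, by omega, by omega, h3, fun l hl hl' => ?_⟩
  have := h4 (k - l) (Nat.zero_le _) (by omega)
  rwa [Nat.sub_sub_self hl'] at this

namespace DWROCA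

variable {M : DWROCA A S}

/-! ### Runs staying above a level -/

@[simp] theorem crun_nil (c : M.Q × ℕ) : M.crun c [] = c := rfl

theorem crun_append (c : M.Q × ℕ) (u v : List A) :
    M.crun c (u ++ v) = M.crun (M.crun c u) v := by
  simp [crun]

/-- All configurations of the run of a word, except possibly the last one, have counter value at
least `h`. -/
def Above (M : DWROCA A S) (h : ℕ) (c : M.Q × ℕ) (u : List A) : Prop :=
  ∀ l < u.length, h ≤ (M.crun c (u.take l)).2

theorem Above.append {h : ℕ} {c : M.Q × ℕ} {u v : List A} (hu : M.Above h c u)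
    (hv : M.Above h (M.crun c u) v) : M.Above h c (u ++ v) := by
  intro l hl
  rcases Nat.lt_or_ge l u.length with h' | h'
  · rw [List.take_append_of_le_length h'.le]
    exact hu l h'
  · rw [List.take_append, List.take_of_length_le h', crun_append]
    exact hv _ (by rw [List.length_append] at hl; omega)

theorem Above.mono {h h' : ℕ} {c : M.Q × ℕ} {u : List A} (hu : M.Above h c u) (hh : h' ≤ h) :
    M.Above h' c u :=
  fun l hl => hh.trans (hu l hl)

/-- Shifting the counter of a configuration shifts its run, as long as both runs stay positive. -/
theorem crun_shift {x : ℤ} {h h' : ℕ} (hh : 1 ≤ h) (hh' : 1 ≤ h') (hx : (h' : ℤ) ≤ h + x)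
    {c c' : M.Q × ℕ} (e1 : c'.1 = c.1) (e2 : (c'.2 : ℤ) = c.2 + x) {u : List A}
    (ha : M.Above h c u) :
    (M.crun c' u).1 = (M.crun c u).1 ∧ ((M.crun c' u).2 : ℤ) = (M.crun c u).2 + x ∧
      M.Above h' c' u := by
  induction u using List.reverseRecOn with
  | nil => exact ⟨e1, e2, fun l hl => absurd hl (by simp)⟩
  | append_singleton u a ih =>
    have hu : M.Above h c u := fun l hl => by
      have := ha l (by simp; omega)
      rwa [List.take_append_of_le_length hl.le] at this
    have hlast : h ≤ (M.crun c u).2 := by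
      have := ha u.length (by simp)
      rwa [List.take_left] at this
    obtain ⟨i1, i2, i3⟩ := ih hu
    have hlast' : h' ≤ (M.crun c' u).2 := by omega
    have d1 : decide ((M.crun c u).2 = 0) = false := by simp; omega
    have d2 : decide ((M.crun c' u).2 = 0) = false := by simp; omega
    have hb := upd_bounds (M := M) (M.crun c u).1 false a
    have key : ∀ b : M.Q × ℕ, M.crun b (u ++ [a]) = M.cstep (M.crun b u) a := fun b => by
      simp [crun]
    refine ⟨?_, ?_, i3.append fun l hl => ?_⟩
    · rw [key, key]
      simp only [cstep, d1, d2, i1]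
    · rw [key, key]
      simp only [cstep, d1, d2, i1]
      omega
    · have : l = 0 := by simpa using hl
      subst this
      simpa using hlast'

theorem crun_snd_lipschitz (c : M.Q × ℕ) (u : List A) (i : ℕ) :
    (M.crun c (u.take (i + 1))).2 ≤ (M.crun c (u.take i)).2 + 1 ∧
      (M.crun c (u.take i)).2 ≤ (M.crun c (u.take (i + 1))).2 + 1 := by
  rcases Nat.lt_or_ge i u.length with h | h
  · rw [List.take_succ_eq_append_getElem h, crun_append]
    exact cstep_snd_bounds _ _
  · rw [List.take_of_length_le h, List.take_of_length_le (by omega)]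
    omega

theorem crun_segment (c : M.Q × ℕ) (u : List A) {i j : ℕ} (hij : i ≤ j) :
    M.crun (M.crun c (u.take i)) ((u.take j).drop i) = M.crun c (u.take j) := by
  rw [← crun_append]
  congr 1
  conv_rhs => rw [← List.take_append_drop i (u.take j)]
  rw [List.take_take, min_eq_left hij]

theorem above_segment {h : ℕ} {c : M.Q × ℕ} {u : List A} {i j : ℕ}
    (hh : ∀ l, i ≤ l → l < j → h ≤ (M.crun c (u.take l)).2) :
    M.Above h (M.crun c (u.take i)) ((u.take j).drop i) := by
  intro l hl
  simp only [List.length_drop, List.length_take] at hl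
  have := crun_segment c u (i := i) (j := i + l) (by omega)
  have e : ((u.take j).drop i).take l = (u.take (i + l)).drop i := by
    rw [List.take_drop, List.take_take, min_eq_left (by omega)]
  rw [e, this]
  exact hh _ (by omega) (by omega)

theorem crun_drop (c : M.Q × ℕ) (u : List A) (i : ℕ) :
    M.crun (M.crun c (u.take i)) (u.drop i) = M.crun c u := by
  rw [← crun_append, List.take_append_drop]

/-! ### Short runs between two configurations -/

theorem exists_shorter {K : ℕ} (hK : Fintype.card M.Q ≤ K) {c : M.Q × ℕ} {u : List A}
    (hlen : K * (max c.2 (M.crun c u).2 + K ^ 2 + 1) < u.length) :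
    ∃ u' : List A, u'.length < u.length ∧ M.crun c u' = M.crun c u ∧
      (M.Above 1 c u → M.Above 1 c u') := by
  classical
  set Y := max c.2 (M.crun c u).2 with hY
  have hseg : ∀ i j, M.Above 1 c u → j ≤ u.length →
      M.Above 1 (M.crun c (u.take i)) ((u.take j).drop i) := fun i j ha hj =>
    above_segment fun l _ hl' => ha l (by omega)
  have htake : ∀ i, i ≤ u.length → M.Above 1 c u → M.Above 1 c (u.take i) := fun i hi ha => by
    simpa using hseg 0 i ha hi
  have hdrop : ∀ i, M.Above 1 c u → M.Above 1 (M.crun c (u.take i)) (u.drop i) := fun i ha => by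
    simpa using hseg i u.length ha le_rfl
  by_cases hall : ∀ i < u.length, (M.crun c (u.take i)).2 ≤ Y + K ^ 2
  · have hcard : ((Finset.univ : Finset M.Q) ×ˢ Finset.range (Y + K ^ 2 + 1)).card <
        (Finset.range u.length).card := by
      rw [Finset.card_product, Finset.card_range, Finset.card_range, Finset.card_univ]
      exact (Nat.mul_le_mul_right _ hK).trans_lt hlen
    obtain ⟨i, hi, j, hj, hij, he⟩ := Finset.exists_ne_map_eq_of_card_lt_of_maps_to hcard
      (f := fun i => M.crun c (u.take i)) (fun i hi => by
        have := hall i (by simpa using hi)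
        simp only [Finset.coe_product, Set.mem_prod, Finset.coe_univ, Set.mem_univ, true_and,
          Finset.coe_range, Set.mem_Iio]
        omega)
    have main : ∀ i j, i < j → j < u.length → M.crun c (u.take i) = M.crun c (u.take j) →
        ∃ u' : List A, u'.length < u.length ∧ M.crun c u' = M.crun c u ∧
          (M.Above 1 c u → M.Above 1 c u') := by
      intro i j hij hj he
      refine ⟨u.take i ++ u.drop j, by simp; omega, ?_, fun ha => ?_⟩
      · rw [crun_append, he, crun_drop]
      · refine (htake i (by omega) ha).append ?_
        rw [he]
        exact hdrop j ha
    simp only [Finset.mem_range] at hi hj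
    rcases Nat.lt_or_gt_of_ne hij with h | h
    · exact main i j h hj he
    · exact main j i h hi he.symm
  · push Not at hall
    obtain ⟨k, hk, hkY⟩ := hall
    have hlev : ∀ j, ∃ a b : ℕ, Y ≤ j → j ≤ (M.crun c (u.take k)).2 →
        (a ≤ k ∧ k ≤ b ∧ b ≤ u.length ∧ (M.crun c (u.take a)).2 = j ∧
          (M.crun c (u.take b)).2 = j ∧ ∀ l, a ≤ l → l ≤ b → j ≤ (M.crun c (u.take l)).2) := by
      intro j
      by_cases hj : Y ≤ j ∧ j ≤ (M.crun c (u.take k)).2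
      · obtain ⟨a, _, a2, a3, a4⟩ := exists_last_ascent
          (f := fun i => (M.crun c (u.take i)).2) (crun_snd_lipschitz c u) (Nat.zero_le k)
          (by simp only [List.take_zero, crun_nil]; omega) hj.2
        obtain ⟨b, b1, b2, b3, b4⟩ := exists_first_descent
          (f := fun i => (M.crun c (u.take i)).2) (crun_snd_lipschitz c u) hk.le
          (by simp only [List.take_length]; omega) hj.2
        refine ⟨a, b, fun _ _ => ⟨a2, b1, b2, a3, b3, fun l hl hl' => ?_⟩⟩
        rcases Nat.lt_or_ge l k with h | h
        · rcases hl.eq_or_lt with h' | h'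
          · rw [← h', a3]
          · exact (a4 l h' h.le).le
        · rcases hl'.eq_or_lt with h' | h'
          · rw [h', b3]
          · exact (b4 l h h').le
      · exact ⟨0, 0, fun h1 h2 => absurd ⟨h1, h2⟩ hj⟩
    choose a b hab using hlev
    have hcard : (Finset.univ : Finset (M.Q × M.Q)).card <
        (Finset.Icc (Y + 1) (Y + 1 + K ^ 2)).card := by
      rw [Finset.card_univ, Fintype.card_prod, Nat.card_Icc]
      have := Nat.mul_le_mul hK hK
      rw [← pow_two K] at this
      omega
    obtain ⟨i, hi, j, hj, hij, he⟩ := Finset.exists_ne_map_eq_of_card_lt_of_maps_to hcard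
      (f := fun j => ((M.crun c (u.take (a j))).1, (M.crun c (u.take (b j))).1))
      (fun _ _ => by simp)
    have main : ∀ i j, i < j → Y + 1 ≤ i → j ≤ Y + 1 + K ^ 2 →
        (M.crun c (u.take (a i))).1 = (M.crun c (u.take (a j))).1 →
        (M.crun c (u.take (b i))).1 = (M.crun c (u.take (b j))).1 →
        ∃ u' : List A, u'.length < u.length ∧ M.crun c u' = M.crun c u ∧
          (M.Above 1 c u → M.Above 1 c u') := by
      intro i j hij hi hj ha hb
      obtain ⟨i1, i2, i3, i4, i5, i6⟩ := hab i (by omega) (by omega)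
      obtain ⟨j1, j2, j3, j4, j5, j6⟩ := hab j (by omega) (by omega)
      have hlt1 : a i < a j := by
        by_contra hcon
        have := j6 (a i) (by omega) (by omega)
        omega
      have hlt2 : b j < b i := by
        by_contra hcon
        have := j6 (b i) (by omega) (by omega)
        omega
      obtain ⟨s1, s2, s3⟩ := crun_shift (M := M) (x := (i : ℤ) - j) (h := j) (h' := i)
        (by omega) (by omega) (by omega) ha (by omega)
        (above_segment (u := u) (j := b j) fun l hl hl' => j6 l hl hl'.le)
      rw [crun_segment c u (by omega)] at s1 s2
      have hmid : M.crun (M.crun c (u.take (a i))) ((u.take (b j)).drop (a j)) =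
          M.crun c (u.take (b i)) := Prod.ext (s1.trans hb.symm) (by omega)
      refine ⟨u.take (a i) ++ (u.take (b j)).drop (a j) ++ u.drop (b i), ?_, ?_, fun h => ?_⟩
      · simp only [List.length_append, List.length_take, List.length_drop]
        omega
      · rw [crun_append, crun_append, hmid, crun_drop]
      · refine ((htake _ (by omega) h).append (s3.mono (by omega))).append ?_
        rw [crun_append, hmid]
        exact hdrop _ h
    simp only [Finset.mem_Icc] at hi hj
    simp only [Prod.mk.injEq] at he
    rcases Nat.lt_or_gt_of_ne hij with h | h
    · exact main i j h hi.1 hj.2 he.1 he.2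
    · exact main j i h hj.1 hi.2 he.1.symm he.2.symm

/-- Every run can be replaced by a short one with the same endpoints. -/
theorem exists_short {K : ℕ} (hK : Fintype.card M.Q ≤ K) (c : M.Q × ℕ) (u : List A) :
    ∃ u' : List A, u'.length ≤ u.length ∧
      u'.length ≤ K * (max c.2 (M.crun c u).2 + K ^ 2 + 1) ∧ M.crun c u' = M.crun c u ∧
      (M.Above 1 c u → M.Above 1 c u') := by
  induction hn : u.length using Nat.strong_induction_on generalizing u with
  | _ n ih =>
    subst hn
    rcases Nat.lt_or_ge (K * (max c.2 (M.crun c u).2 + K ^ 2 + 1)) u.length with h | h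
    · obtain ⟨u', h1, h2, h3⟩ := exists_shorter hK h
      obtain ⟨u'', i1, i2, i3, i4⟩ := ih _ h1 u' rfl
      rw [h2] at i2 i3
      exact ⟨u'', i1.trans h1.le, i2, i3, fun ha => i4 (h3 ha)⟩
    · exact ⟨u, le_rfl, h, rfl, id⟩

/-! ### Descents -/

/-- There is a run of length `t` from state `p` to state `r` which lowers the counter by `N` and
reaches its lowest level only at the end. -/
def Desc (M : DWROCA A S) (N t : ℕ) (p r : M.Q) : Prop :=
  ∃ u : List A, u.length = t ∧ M.crun (p, N) u = (r, 0) ∧ M.Above 1 (p, N) u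

theorem Desc.refl (p : M.Q) : M.Desc 0 0 p p :=
  ⟨[], rfl, rfl, fun l hl => absurd hl (by simp)⟩

theorem Desc.lift {N t : ℕ} {p r : M.Q} (h : M.Desc N t p r) (x : ℕ) :
    ∃ u : List A, u.length = t ∧ M.crun (p, N + x) u = (r, x) ∧ M.Above (x + 1) (p, N + x) u := by
  obtain ⟨u, h1, h2, h3⟩ := h
  obtain ⟨s1, s2, s3⟩ := crun_shift (x := (x : ℤ)) (h := 1) (h' := x + 1) (c := (p, N))
    (c' := (p, N + x)) le_rfl (by omega) (by push_cast; omega) rfl (by push_cast; rfl) h3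
  rw [h2] at s1 s2
  exact ⟨u, h1, Prod.ext s1 (by simpa using s2), s3⟩

theorem desc_of_crun {N x : ℕ} {p r : M.Q} {u : List A} (h : M.crun (p, N + x) u = (r, x))
    (ha : M.Above (x + 1) (p, N + x) u) : M.Desc N u.length p r := by
  obtain ⟨s1, s2, s3⟩ := crun_shift (x := -(x : ℤ)) (h := x + 1) (h' := 1) (c := (p, N + x))
    (c' := (p, N)) (by omega) le_rfl (by push_cast; omega) rfl (by push_cast; ring) ha
  rw [h] at s1 s2
  exact ⟨u, rfl, Prod.ext s1 (by simpa using s2), s3⟩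

theorem Desc.trans {N N' t t' : ℕ} {p s r : M.Q} (h : M.Desc N t p s) (h' : M.Desc N' t' s r) :
    M.Desc (N + N') (t + t') p r := by
  obtain ⟨u, h1, h2, h3⟩ := h.lift N'
  obtain ⟨v, i1, i2, i3⟩ := h'
  refine ⟨u ++ v, by simp [h1, i1], by rw [crun_append, h2, i2], ?_⟩
  exact (h3.mono (by omega)).append (by rwa [h2])

theorem Desc.split {N N' t : ℕ} {p r : M.Q} (h : M.Desc (N + N') t p r) :
    ∃ s t₁ t₂, t₁ + t₂ = t ∧ M.Desc N t₁ p s ∧ M.Desc N' t₂ s r := by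
  obtain ⟨u, h1, h2, h3⟩ := h
  obtain ⟨v, -, v2, v3, v4⟩ := exists_first_descent
    (f := fun i => (M.crun (p, N + N') (u.take i)).2) (crun_snd_lipschitz _ u)
    (k := 0) (e := u.length) (j := N') (Nat.zero_le _)
    (by simp [h2]) (by simp)
  have e : M.crun (p, N + N') (u.take v) = ((M.crun (p, N + N') (u.take v)).1, N') :=
    Prod.ext rfl v3
  refine ⟨(M.crun (p, N + N') (u.take v)).1, v, t - v, by omega, ?_, ?_⟩
  · have := desc_of_crun e fun l hl => by
      rw [List.length_take] at hl
      rw [List.take_take, min_eq_left (by omega)]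
      exact v4 l (Nat.zero_le _) (by omega)
    rwa [List.length_take, min_eq_left v2] at this
  · refine ⟨u.drop v, by simp [h1], ?_, ?_⟩
    · rw [← e, crun_drop, h2]
    · rw [← e]
      have := above_segment (M := M) (h := 1) (c := (p, N + N')) (u := u) (i := v) (j := u.length)
        fun l _ hl => h3 l hl
      simpa using this

theorem Desc.le {N t : ℕ} {p r : M.Q} (h : M.Desc N t p r) : N ≤ t := by
  obtain ⟨u, rfl, h2, -⟩ := h
  have key : ∀ i, N ≤ (M.crun (p, N) (u.take i)).2 + i := fun i => by
    induction i with
    | zero => simp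
    | succ i ih =>
      have := (crun_snd_lipschitz (p, N) u i).2
      omega
  have := key u.length
  rwa [List.take_length, h2, Nat.zero_add] at this

theorem Desc.short {K : ℕ} (hK : Fintype.card M.Q ≤ K) {N t : ℕ} {p r : M.Q}
    (h : M.Desc N t p r) : ∃ t' ≤ t, t' ≤ K * (N + K ^ 2 + 1) ∧ M.Desc N t' p r := by
  obtain ⟨u, rfl, h2, h3⟩ := h
  obtain ⟨u', h4, h5, h6, h7⟩ := exists_short hK (p, N) u
  rw [h2] at h5 h6
  exact ⟨u'.length, h4, by simpa using h5, u', rfl, h6, h7 h3⟩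

/-- The depth of a descent can be made small without changing its residue modulo `δ`. -/
theorem Desc.reduce {K : ℕ} (hK : Fintype.card M.Q ≤ K) {δ : ℕ} (hδ : 1 ≤ δ) {N t : ℕ} {p r : M.Q}
    (h : M.Desc N t p r) :
    ∃ N' t' j, N' + j * δ = N ∧ N' ≤ K * δ ∧ M.Desc N' t' p r := by
  classical
  induction N using Nat.strong_induction_on generalizing t with
  | _ N ih =>
    rcases Nat.lt_or_ge (K * δ) N with hN | hN
    · have hs : ∀ i, ∃ s t₁ t₂, i ≤ N → M.Desc i t₁ p s ∧ M.Desc (N - i) t₂ s r := fun i => by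
        by_cases hi : i ≤ N
        · rw [← Nat.add_sub_of_le hi] at h
          obtain ⟨s, t₁, t₂, -, h1, h2⟩ := h.split
          exact ⟨s, t₁, t₂, fun _ => ⟨h1, h2⟩⟩
        · exact ⟨p, 0, 0, fun h => absurd h hi⟩
      choose s t₁ t₂ hst using hs
      have hcard : ((Finset.univ : Finset M.Q) ×ˢ Finset.range δ).card <
          (Finset.range (K * δ + 1)).card := by
        rw [Finset.card_product, Finset.card_range, Finset.card_range, Finset.card_univ]
        exact Nat.lt_succ_of_le (Nat.mul_le_mul_right _ hK)
      obtain ⟨i, hi, j, hj, hij, he⟩ := Finset.exists_ne_map_eq_of_card_lt_of_maps_to hcard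
        (f := fun i => (s i, i % δ)) (fun i _ => by simp [Nat.mod_lt i hδ])
      have main : ∀ i j, i < j → j < K * δ + 1 → s i = s j → i % δ = j % δ →
          ∃ N' t' j, N' + j * δ = N ∧ N' ≤ K * δ ∧ M.Desc N' t' p r := by
        intro i j hij hj hs hm
        have h2 := (hst j (by omega)).2
        rw [← hs] at h2
        obtain ⟨q, hq⟩ := (Nat.modEq_iff_dvd' hij.le).1 hm
        obtain ⟨N', t', m, m1, m2, m3⟩ := ih _ (by omega) ((hst i (by omega)).1.trans h2)
        refine ⟨N', t', m + q, ?_, m2, m3⟩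
        rw [add_mul, mul_comm q δ, ← hq]
        omega
      simp only [Finset.mem_range, Prod.mk.injEq] at hi hj he
      rcases Nat.lt_or_gt_of_ne hij with h' | h'
      · exact main i j h' hj he.1 he.2
      · exact main j i h' hi he.1.symm he.2.symm
    · exact ⟨N, t, 0, by simp, hN, h⟩

theorem Desc.iterate {δ ℓ : ℕ} {s : M.Q} (h : M.Desc δ ℓ s s) (j : ℕ) :
    M.Desc (j * δ) (j * ℓ) s s := by
  induction j with
  | zero => simpa using Desc.refl s
  | succ j ih => simpa [add_mul] using ih.trans h

/-- Descents decomposed into descents by one through states of the set `V`. -/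
inductive VDesc (M : DWROCA A S) (V : Set M.Q) : ℕ → ℕ → M.Q → M.Q → Prop
  | nil {a : M.Q} (ha : a ∈ V) : VDesc M V 0 0 a a
  | cons {a b c : M.Q} {e N t : ℕ} (ha : a ∈ V) (h : M.Desc 1 e a b) (h' : VDesc M V N t b c) :
      VDesc M V (N + 1) (e + t) a c

theorem VDesc.desc {V : Set M.Q} {N t : ℕ} {a b : M.Q} (h : M.VDesc V N t a b) :
    M.Desc N t a b := by
  induction h with
  | nil _ => exact Desc.refl _
  | cons _ h _ ih => simpa [add_comm] using h.trans ih

theorem VDesc.mem {V : Set M.Q} {N t : ℕ} {a b : M.Q} (h : M.VDesc V N t a b) : a ∈ V := by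
  cases h <;> assumption

theorem VDesc.trans {V : Set M.Q} {N N' t t' : ℕ} {a b c : M.Q} (h : M.VDesc V N t a b)
    (h' : M.VDesc V N' t' b c) : M.VDesc V (N + N') (t + t') a c := by
  induction h with
  | nil _ => simpa using h'
  | cons ha h _ ih =>
    have := VDesc.cons ha h (ih h')
    rwa [← add_assoc, add_right_comm] at this

/-- The states and times at which the levels of a decomposed descent are reached. -/
theorem VDesc.exists_profile {V : Set M.Q} {N t : ℕ} {a b : M.Q} (h : M.VDesc V N t a b) :
    ∃ (s : ℕ → M.Q) (g : ℕ → ℕ), s 0 = a ∧ s N = b ∧ g 0 = 0 ∧ g N = t ∧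
      ∀ i j, i ≤ j → j ≤ N → g i ≤ g j ∧ M.VDesc V (j - i) (g j - g i) (s i) (s j) := by
  induction h with
  | @nil a ha =>
    refine ⟨fun _ => a, fun _ => 0, rfl, rfl, rfl, rfl, fun i j hij hj => ⟨le_rfl, ?_⟩⟩
    obtain rfl : j = 0 := by omega
    simpa using VDesc.nil ha
  | @cons a b c e N t ha h h' ih =>
    obtain ⟨s, g, h1, h2, h3, h4, h5⟩ := ih
    refine ⟨fun i => Nat.casesOn i a s, fun i => Nat.casesOn i 0 fun i => e + g i, rfl, h2, rfl,
      by simp [h4], fun i j hij hj => ?_⟩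
    rcases i with _ | i <;> rcases j with _ | j
    · simpa using VDesc.nil ha
    · obtain ⟨_, h7⟩ := h5 0 j (Nat.zero_le _) (by omega)
      rw [h1, h3] at h7
      exact ⟨Nat.zero_le _, by simpa using VDesc.cons ha h h7⟩
    · omega
    · obtain ⟨h6, h7⟩ := h5 i j (by omega) (by omega)
      refine ⟨by simpa using h6, ?_⟩
      simpa [Nat.add_sub_add_left] using h7

theorem Desc.vdesc {V : Set M.Q} {N₀ N t : ℕ} {p₀ a r : M.Q}
    (hV : ∀ s N₁ N₂ t₁ t₂, N₁ + N₂ = N₀ → M.Desc N₁ t₁ p₀ s → M.Desc N₂ t₂ s r → s ∈ V)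
    (h : M.Desc N t a r) {N₁ t₁ : ℕ} (h₁ : M.Desc N₁ t₁ p₀ a) (hN : N₁ + N = N₀) :
    M.VDesc V N t a r := by
  induction N generalizing t a N₁ t₁ with
  | zero =>
    have ha := hV a N₁ 0 t₁ t hN h₁ h
    obtain ⟨u, rfl, h2, h3⟩ := h
    rcases u with _ | ⟨x, u⟩
    · obtain rfl : a = r := congrArg Prod.fst h2
      exact VDesc.nil ha
    · exact absurd (h3 0 (by simp)) (by simp)
  | succ N ih =>
    have ha := hV a N₁ (N + 1) t₁ t hN h₁ h
    rw [add_comm] at h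
    obtain ⟨s, t₂, t₃, rfl, h2, h3⟩ := h.split
    exact VDesc.cons ha h2 (ih h3 (h₁.trans h2) (by omega))

theorem VDesc.exists_cycle {K : ℕ} (hK : Fintype.card M.Q ≤ K) {V : Set M.Q} {N t : ℕ} {a b : M.Q}
    (h : M.VDesc V N t a b) (hN : K ≤ N) :
    ∃ δ ℓ N' t', ∃ s ∈ V, 1 ≤ δ ∧ δ ≤ K ∧ M.Desc δ ℓ s s ∧ M.VDesc V N' t' a b ∧ N' + δ = N ∧
      t' + ℓ = t := by
  classical
  obtain ⟨s, g, rfl, rfl, h3, h4, h5⟩ := h.exists_profile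
  have hcard : (Finset.univ : Finset M.Q).card < (Finset.range (K + 1)).card := by
    rw [Finset.card_range, Finset.card_univ]
    omega
  obtain ⟨i, hi, j, hj, hij, he⟩ := Finset.exists_ne_map_eq_of_card_lt_of_maps_to hcard
    (f := s) (fun i _ => by simp)
  have main : ∀ i j, i < j → j < K + 1 → s i = s j →
      ∃ δ ℓ N' t', ∃ s' ∈ V, 1 ≤ δ ∧ δ ≤ K ∧ M.Desc δ ℓ s' s' ∧ M.VDesc V N' t' (s 0) (s N) ∧
        N' + δ = N ∧ t' + ℓ = t := by
    intro i j hij hj he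
    obtain ⟨a1, a2⟩ := h5 0 i (by omega) (by omega)
    obtain ⟨b1, b2⟩ := h5 i j (by omega) (by omega)
    obtain ⟨c1, c2⟩ := h5 j N (by omega) (by omega)
    rw [he] at a2
    refine ⟨j - i, g j - g i, _, _, s i, b2.mem, by omega, by omega, ?_, a2.trans c2, by omega,
      by omega⟩
    have := b2.desc
    rwa [← he] at this
  simp only [Finset.mem_range] at hi hj
  rcases Nat.lt_or_gt_of_ne hij with h' | h'
  · exact main i j h' hj he
  · exact main j i h' hi he.symm

theorem VDesc.lower_bound {K : ℕ} (hK : Fintype.card M.Q ≤ K) {V : Set M.Q} {δ₀ ℓ₀ : ℕ}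
    (hmin : ∀ δ ℓ, ∀ s ∈ V, 1 ≤ δ → δ ≤ K → M.Desc δ ℓ s s → ℓ₀ * δ ≤ δ₀ * ℓ)
    {N t : ℕ} {a b : M.Q} (h : M.VDesc V N t a b) : ℓ₀ * N ≤ δ₀ * t + ℓ₀ * K := by
  induction N using Nat.strong_induction_on generalizing t with
  | _ N ih =>
    rcases Nat.lt_or_ge N K with hN | hN
    · have := Nat.mul_le_mul_left ℓ₀ hN.le
      omega
    · obtain ⟨δ, ℓ, N', t', s, hs, h1, h2, h3, h4, rfl, rfl⟩ := h.exists_cycle hK hN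
      have := ih N' (by omega) h4
      have := hmin δ ℓ s hs h1 h2 h3
      rw [mul_add, mul_add]
      omega

/-- The minimal length of a descent is, up to an additive constant, proportional to its depth. -/
theorem Desc.exists_slope {K : ℕ} (hK : Fintype.card M.Q ≤ K) {N t : ℕ} {p r : M.Q}
    (h : M.Desc N t p r) (hmin : ∀ t', M.Desc N t' p r → t ≤ t') :
    ∃ δ ℓ, 1 ≤ δ ∧ δ ≤ K ∧ 1 ≤ ℓ ∧ ℓ ≤ K * (K + K ^ 2 + 1) ∧
      δ * t ≤ ℓ * N + K * (2 * (K * (2 * K ^ 2 + 1))) ∧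
      ℓ * N ≤ δ * t + K * (K + K ^ 2 + 1) * K := by
  classical
  have hK1 : 1 ≤ K := le_trans (Fintype.card_pos_iff.2 ⟨p⟩) hK
  set V : Set M.Q := {s | ∃ N₁ N₂ t₁ t₂, N₁ + N₂ = N ∧ M.Desc N₁ t₁ p s ∧ M.Desc N₂ t₂ s r} with hV
  have hv : M.VDesc V N t p r := h.vdesc (N₀ := N) (p₀ := p)
    (fun s N₁ N₂ t₁ t₂ h1 h2 h3 => ⟨N₁, N₂, t₁, t₂, h1, h2, h3⟩) (Desc.refl p) (by simp)
  set C : Set (ℕ × ℕ) := {x | 1 ≤ x.1 ∧ x.1 ≤ K ∧ x.2 ≤ K * (K + K ^ 2 + 1) ∧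
    ∃ s ∈ V, M.Desc x.1 x.2 s s} with hC
  have hCfin : C.Finite := by
    refine ((Finset.range (K + 1)) ×ˢ (Finset.range (K * (K + K ^ 2 + 1) + 1))).finite_toSet.subset
      fun x hx => ?_
    simp only [Finset.coe_product, Finset.coe_range, Set.mem_prod, Set.mem_Iio]
    exact ⟨Nat.lt_succ_of_le hx.2.1, Nat.lt_succ_of_le hx.2.2.1⟩
  have hshort : ∀ δ ℓ, ∀ s ∈ V, 1 ≤ δ → δ ≤ K → M.Desc δ ℓ s s → ∃ ℓ' ≤ ℓ, (δ, ℓ') ∈ C := by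
    intro δ ℓ s hs h1 h2 h3
    obtain ⟨ℓ', h4, h5, h6⟩ := h3.short hK
    exact ⟨ℓ', h4, h1, h2, h5.trans (Nat.mul_le_mul_left _ (by omega)), s, hs, h6⟩
  rcases C.eq_empty_or_nonempty with hCe | hCn
  · have hN : N < K := by
      by_contra hcon
      obtain ⟨δ, ℓ, -, -, s, hs, h1, h2, h3, -⟩ := hv.exists_cycle hK (by omega)
      obtain ⟨ℓ', -, h5⟩ := hshort δ ℓ s hs h1 h2 h3
      rw [hCe] at h5
      exact h5
    obtain ⟨t', h1, h2, h3⟩ := h.short hK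
    have h4 := hmin t' h3
    have h5 := h.le
    refine ⟨1, 1, le_rfl, hK1, le_rfl, by nlinarith, ?_, by nlinarith⟩
    have : K * (N + K ^ 2 + 1) ≤ K * (2 * (K * (2 * K ^ 2 + 1))) :=
      Nat.mul_le_mul_left _ (by nlinarith)
    omega
  · obtain ⟨⟨δ, ℓ⟩, ⟨c1, c2, c3, s, ⟨N₁, N₂, t₁, t₂, hN, d1, d2⟩, d3⟩, hle⟩ :=
      Set.exists_min_image C (fun x => (x.2 : ℚ) / x.1) hCfin hCn
    simp only at c1 c2 c3 d3 hle
    refine ⟨δ, ℓ, c1, c2, c1.trans d3.le, c3, ?_, ?_⟩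
    · obtain ⟨N₁', t₁', j₁, e1, e2, e3⟩ := d1.reduce hK c1
      obtain ⟨N₂', t₂', j₂, f1, f2, f3⟩ := d2.reduce hK c1
      obtain ⟨t₁'', -, e4, e5⟩ := e3.short hK
      obtain ⟨t₂'', -, f4, f5⟩ := f3.short hK
      have hcomb := (e5.trans (d3.iterate (j₁ + j₂))).trans f5
      rw [show N₁' + (j₁ + j₂) * δ + N₂' = N by rw [add_mul]; omega] at hcomb
      have h1 := hmin _ hcomb
      have h2 : K * δ ≤ K ^ 2 := by rw [pow_two]; exact Nat.mul_le_mul_left _ c2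
      have h3 : t₁'' ≤ K * (2 * K ^ 2 + 1) := e4.trans (Nat.mul_le_mul_left _ (by omega))
      have h4 : t₂'' ≤ K * (2 * K ^ 2 + 1) := f4.trans (Nat.mul_le_mul_left _ (by omega))
      have h5 : (j₁ + j₂) * δ ≤ N := by rw [add_mul]; omega
      calc δ * t ≤ δ * ((j₁ + j₂) * ℓ + 2 * (K * (2 * K ^ 2 + 1))) :=
            Nat.mul_le_mul_left _ (by omega)
        _ = ℓ * ((j₁ + j₂) * δ) + δ * (2 * (K * (2 * K ^ 2 + 1))) := by ring
        _ ≤ _ := Nat.add_le_add (Nat.mul_le_mul_left _ h5) (Nat.mul_le_mul_right _ c2)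
    · refine (hv.lower_bound hK (δ₀ := δ) (ℓ₀ := ℓ) ?_).trans
        (Nat.add_le_add_left (Nat.mul_le_mul_right _ c3) _)
      intro δ' ℓ' s' hs' h1 h2 h3
      obtain ⟨ℓ'', h4, h5⟩ := hshort δ' ℓ' s' hs' h1 h2 h3
      have h6 := hle _ h5
      simp only at h6
      rw [div_le_div_iff₀ (by exact_mod_cast c1) (by exact_mod_cast h1)] at h6
      have h7 : ℓ * δ' ≤ ℓ'' * δ := by exact_mod_cast h6
      calc ℓ * δ' ≤ ℓ'' * δ := h7
        _ ≤ ℓ' * δ := Nat.mul_le_mul_right _ h4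
        _ = δ * ℓ' := mul_comm _ _

/-! ### The distance to the exceptional configurations -/

/-- A configuration is exceptional if it is not `(K + 1)`-equivalent to any state of `uwa(M)`. -/
def Exc (M : DWROCA A S) (K : ℕ) (c : M.Q × ℕ) : Prop :=
  ∀ s : M.Q, ¬ M.Eqv (K + 1) (.inl c) (.inr s)

/-- An exceptional configuration is reachable by a word of length at most `t`. -/
def DistLe (M : DWROCA A S) (K t : ℕ) (c : M.Q × ℕ) : Prop :=
  ∃ u : List A, u.length ≤ t ∧ M.Exc K (M.crun c u)

theorem Exc.snd_le {K : ℕ} {c : M.Q × ℕ} (h : M.Exc K c) : c.2 ≤ K := by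
  by_contra hc
  exact h c.1 (eqv_state (by omega))

theorem DistLe.mono {K t t' : ℕ} {c : M.Q × ℕ} (h : M.DistLe K t c) (ht : t ≤ t') :
    M.DistLe K t' c := by
  obtain ⟨u, h1, h2⟩ := h
  exact ⟨u, h1.trans ht, h2⟩

theorem DistLe.of_cstep {K t : ℕ} {c : M.Q × ℕ} {x : A} (h : M.DistLe K t (M.cstep c x)) :
    M.DistLe K (t + 1) c := by
  obtain ⟨u, h1, h2⟩ := h
  exact ⟨x :: u, by simpa using h1, h2⟩

theorem eqv_state_of_not_distLe {K : ℕ} (hK : Fintype.card M.Q ≤ K) {j : ℕ} {c : M.Q × ℕ} {s : M.Q}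
    (hd : ¬ M.DistLe K j c) (h : M.Eqv (K + 1) (.inl c) (.inr s)) :
    M.Eqv (K + 1 + j) (.inl c) (.inr s) := by
  induction j generalizing c s with
  | zero => exact h
  | succ j ih =>
    intro x
    refine ⟨(h x).1, ?_⟩
    have hd' : ¬ M.DistLe K j (M.cstep c x) := fun h' => hd h'.of_cstep
    have hne : ¬ M.Exc K (M.cstep c x) := fun h' => hd' ⟨[], by simp, h'⟩
    simp only [Exc, not_forall, not_not] at hne
    obtain ⟨s', hs'⟩ := hne
    have h1 : M.Eqv K (.inr s') (.inr (M.next s false x)) := hs'.pred.symm.trans (h x).2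
    exact (ih hd' hs').trans (h1.of_card_le hK _)

theorem eqv_of_not_distLe {K : ℕ} (hK : Fintype.card M.Q ≤ K) {j : ℕ} {c d : M.Q × ℕ}
    (hc : ¬ M.DistLe K j c) (hd : ¬ M.DistLe K j d) (h : M.Eqv (K + 1) (.inl c) (.inl d)) :
    M.Eqv (K + 1 + j) (.inl c) (.inl d) := by
  have hne : ¬ M.Exc K c := fun h' => hc ⟨[], by simp, h'⟩
  simp only [Exc, not_forall, not_not] at hne
  obtain ⟨s, hs⟩ := hne
  exact (eqv_state_of_not_distLe hK hc hs).trans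
    (eqv_state_of_not_distLe hK hd (h.symm.trans hs)).symm

theorem Eqv.crun {k : ℕ} {c d : M.Q × ℕ} {u : List A}
    (h : M.Eqv (k + u.length) (.inl c) (.inl d)) :
    M.Eqv k (.inl (M.crun c u)) (.inl (M.crun d u)) := by
  induction u generalizing c d with
  | nil => exact h
  | cons x u ih => exact ih (h x).2

theorem exists_min_distLe {K t : ℕ} {c : M.Q × ℕ} (h : M.DistLe K t c) :
    ∃ t' ≤ t, M.DistLe K t' c ∧ ∀ u : List A, M.Exc K (M.crun c u) → t' ≤ u.length := by
  classical
  have hex : ∃ t, M.DistLe K t c := ⟨t, h⟩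
  exact ⟨Nat.find hex, Nat.find_min' hex h, Nat.find_spec hex,
    fun u hu => Nat.find_min' hex ⟨u, le_rfl, hu⟩⟩

theorem DistLe.bound {K : ℕ} (hK : Fintype.card M.Q ≤ K) {t : ℕ} {c : M.Q × ℕ}
    (h : M.DistLe K t c) : M.DistLe K (K * (max c.2 K + K ^ 2 + 1)) c := by
  obtain ⟨u, -, h2⟩ := h
  obtain ⟨u', -, h3, h4, -⟩ := exists_short hK c u
  refine ⟨u', h3.trans (Nat.mul_le_mul_left _ ?_), by rwa [h4]⟩
  have := h2.snd_le
  omega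

/-- A run to an exceptional configuration can be shortened between two levels which it first
reaches in the same state. -/
theorem DistLe.exists_shift {K t : ℕ} {c : M.Q × ℕ} (h : M.DistLe K t c) :
    ∃ r : ℕ → M.Q, ∀ j j', K ≤ j → j < j' → j' ≤ c.2 → r j = r j' →
      M.DistLe K t (c.1, c.2 - (j' - j)) := by
  obtain ⟨u, h1, h2⟩ := h
  have hv : ∀ j, ∃ v, K ≤ j → j ≤ c.2 → v ≤ u.length ∧ (M.crun c (u.take v)).2 = j ∧
      ∀ l < v, j < (M.crun c (u.take l)).2 := by
    intro j
    by_cases hj : K ≤ j ∧ j ≤ c.2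
    · obtain ⟨v, -, v1, v2, v3⟩ := exists_first_descent
        (f := fun i => (M.crun c (u.take i)).2) (crun_snd_lipschitz c u)
        (k := 0) (e := u.length) (j := j) (Nat.zero_le _)
        (by simpa using h2.snd_le.trans hj.1) (by simpa using hj.2)
      exact ⟨v, fun _ _ => ⟨v1, v2, fun l hl => v3 l (Nat.zero_le _) hl⟩⟩
    · exact ⟨0, fun h h' => absurd ⟨h, h'⟩ hj⟩
  choose v hv using hv
  refine ⟨fun j => (M.crun c (u.take (v j))).1, fun j j' hj hjj hj' hr => ?_⟩
  obtain ⟨a1, a2, a3⟩ := hv j hj (by omega)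
  obtain ⟨b1, b2, b3⟩ := hv j' (by omega) hj'
  have hle : v j' ≤ v j := by
    by_contra hlt
    have := b3 (v j) (by omega)
    omega
  obtain ⟨s1, s2, -⟩ := crun_shift (M := M) (x := -((j' - j : ℕ) : ℤ)) (h := j' + 1) (h' := 1)
    (c := c) (c' := (c.1, c.2 - (j' - j))) (u := u.take (v j')) (by omega) le_rfl (by omega) rfl
    (by push_cast; omega) (fun l hl => by
      rw [List.length_take] at hl
      rw [List.take_take, min_eq_left (by omega)]
      exact b3 l (by omega))
  have e : M.crun (c.1, c.2 - (j' - j)) (u.take (v j')) = M.crun c (u.take (v j)) :=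
    Prod.ext (s1.trans hr.symm) (by omega)
  refine ⟨u.take (v j') ++ u.drop (v j), by simp; omega, ?_⟩
  rwa [crun_append, e, crun_drop]

/-- The distance to the exceptional configurations is, up to an additive constant, proportional to
the counter value. -/
theorem exists_dist_slope {K : ℕ} (hK : Fintype.card M.Q ≤ K) (hK2 : 2 ≤ K) {t : ℕ} {c : M.Q × ℕ}
    (h : M.DistLe K t c) (hmin : ∀ u : List A, M.Exc K (M.crun c u) → t ≤ u.length) :
    ∃ δ ℓ : ℕ, 1 ≤ δ ∧ δ ≤ K ∧ 1 ≤ ℓ ∧ ℓ ≤ 2 * K ^ 3 ∧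
      δ * t ≤ ℓ * c.2 + 8 * K ^ 4 ∧ ℓ * c.2 ≤ δ * t + 8 * K ^ 4 := by
  obtain ⟨u, h1, h2⟩ := h
  obtain rfl : u.length = t := le_antisymm h1 (hmin u h2)
  have hK2' : 2 * K ≤ K ^ 2 := by nlinarith
  have hK3 : 2 * K ^ 2 ≤ K ^ 3 := by nlinarith [sq_nonneg K]
  have hK4 : 2 * K ^ 3 ≤ K ^ 4 := by nlinarith [sq_nonneg K, pow_pos (show 0 < K by omega) 3]
  have hs : K * (K + K ^ 2 + 1) ≤ 2 * K ^ 3 := by nlinarith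
  rcases Nat.lt_or_ge K c.2 with hm | hm
  · obtain ⟨v, -, v1, v2, v3⟩ := exists_first_descent
      (f := fun i => (M.crun c (u.take i)).2) (crun_snd_lipschitz c u)
      (k := 0) (e := u.length) (j := K) (Nat.zero_le _)
      (by simpa using h2.snd_le) (by simpa using hm.le)
    obtain ⟨p, m⟩ := c
    obtain ⟨N, rfl⟩ : ∃ N, m = N + K := ⟨m - K, by simp at hm; omega⟩
    set r := (M.crun (p, N + K) (u.take v)).1 with hr
    have er : M.crun (p, N + K) (u.take v) = (r, K) := Prod.ext rfl v2
    have hdesc : M.Desc N v p r := by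
      have := desc_of_crun er fun l hl => by
        rw [List.length_take] at hl
        rw [List.take_take, min_eq_left (by omega)]
        exact v3 l (Nat.zero_le _) (by omega)
      rwa [List.length_take, min_eq_left v1] at this
    have hdrop := crun_drop (M := M) (p, N + K) u v
    obtain ⟨δ, ℓ, d1, d2, d3, d4, d5, d6⟩ := hdesc.exists_slope hK fun t' ht' => by
      obtain ⟨u', e1, e2, -⟩ := ht'.lift K
      have := hmin (u' ++ u.drop v) (by rwa [crun_append, e2, ← er, hdrop])
      simp only [List.length_append, List.length_drop, e1] at this
      omega
    obtain ⟨u', f1, f2, f3, -⟩ := exists_short hK (r, K) (u.drop v)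
    rw [← er, hdrop] at f2 f3
    have hrest : u.length ≤ v + 2 * K ^ 3 := by
      have h3 := hmin (u.take v ++ u') (by rwa [crun_append, f3])
      have h4 := h2.snd_le
      rw [er] at f2
      simp only [List.length_append, List.length_take] at h3
      rw [max_eq_left (by simpa using h4)] at f2
      simp only at f2
      omega
    refine ⟨δ, ℓ, d1, d2, d3, d4.trans hs, ?_, ?_⟩
    · have h3 : δ * u.length ≤ δ * v + K * (2 * K ^ 3) :=
        (Nat.mul_le_mul_left δ hrest).trans (by
          rw [mul_add]; exact Nat.add_le_add_left (Nat.mul_le_mul_right _ d2) _)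
      simp only [mul_add]
      nlinarith
    · have h3 := Nat.mul_le_mul_left δ v1
      have h4 : ℓ * K ≤ 2 * K ^ 3 * K := Nat.mul_le_mul_right _ (d4.trans hs)
      simp only [mul_add]
      nlinarith
  · refine ⟨1, 1, le_rfl, by omega, le_rfl, by nlinarith, ?_, by nlinarith⟩
    obtain ⟨u', -, f2, f3, -⟩ := exists_short hK c u
    have h3 := hmin u' (by rwa [f3])
    have h4 := h2.snd_le
    have h5 : u'.length ≤ K * (K + K ^ 2 + 1) := f2.trans (Nat.mul_le_mul_left _ (by omega))
    omega

/-! ### Belts -/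

/-- The numerators and denominators of the slopes of belts. -/
def IsSlope (K α β : ℕ) : Prop :=
  1 ≤ α ∧ α ≤ 2 * K ^ 4 ∧ 1 ≤ β ∧ β ≤ 2 * K ^ 4 ∧ Nat.Coprime α β

/-- The pair of counter values `(m, n)` lies in some belt. -/
def Good (K m n : ℕ) : Prop :=
  ∃ α β : ℕ, IsSlope K α β ∧ |(α : ℤ) * m - β * n| ≤ 16 * K ^ 5

theorem IsSlope.symm {K α β : ℕ} (h : IsSlope K α β) : IsSlope K β α :=
  ⟨h.2.2.1, h.2.2.2.1, h.1, h.2.1, h.2.2.2.2.symm⟩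

theorem Good.symm {K m n : ℕ} (h : Good K m n) : Good K n m := by
  obtain ⟨α, β, h1, h2⟩ := h
  exact ⟨β, α, h1.symm, by rwa [abs_sub_comm]⟩

theorem good_of_bound {K α β m n : ℕ} (h1 : 1 ≤ α) (h2 : α ≤ 2 * K ^ 4) (h3 : 1 ≤ β)
    (h4 : β ≤ 2 * K ^ 4) (h : |(α : ℤ) * m - β * n| ≤ 16 * K ^ 5) : Good K m n := by
  obtain ⟨g, α', β', hg, hco, rfl, rfl⟩ := Nat.exists_coprime' (Nat.gcd_pos_of_pos_left β h1)
  have ha : 1 ≤ α' := Nat.pos_of_mul_pos_right h1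
  have hb : 1 ≤ β' := Nat.pos_of_mul_pos_right h3
  refine ⟨α', β', ⟨ha, (Nat.le_mul_of_pos_right _ hg).trans h2, hb,
    (Nat.le_mul_of_pos_right _ hg).trans h4, hco⟩, ?_⟩
  have e : ((α' * g : ℕ) : ℤ) * m - (β' * g : ℕ) * n = (α' * m - β' * n) * g := by
    push_cast; ring
  rw [e, abs_mul, Nat.abs_cast] at h
  exact (le_mul_of_one_le_right (abs_nonneg _) (by exact_mod_cast hg)).trans h

theorem good_of_dist_eq {K : ℕ} (hK : Fintype.card M.Q ≤ K) (hK2 : 2 ≤ K) {t : ℕ} {c d : M.Q × ℕ}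
    (hc : M.DistLe K t c) (hcm : ∀ u : List A, M.Exc K (M.crun c u) → t ≤ u.length)
    (hd : M.DistLe K t d) (hdm : ∀ u : List A, M.Exc K (M.crun d u) → t ≤ u.length) :
    Good K c.2 d.2 := by
  obtain ⟨δ₁, ℓ₁, a1, a2, a3, a4, a5, a6⟩ := exists_dist_slope hK hK2 hc hcm
  obtain ⟨δ₂, ℓ₂, b1, b2, b3, b4, b5, b6⟩ := exists_dist_slope hK hK2 hd hdm
  have e : 2 * K ^ 4 = 2 * K ^ 3 * K := by ring
  refine good_of_bound (α := ℓ₁ * δ₂) (β := ℓ₂ * δ₁) (Nat.mul_pos a3 b1)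
    (e ▸ Nat.mul_le_mul a4 b2) (Nat.mul_pos b3 a1) (e ▸ Nat.mul_le_mul b4 a2) ?_
  have k1 : δ₂ * (8 * K ^ 4) ≤ 8 * K ^ 5 := by
    calc _ ≤ K * (8 * K ^ 4) := Nat.mul_le_mul_right _ b2
      _ = _ := by ring
  have k2 : δ₁ * (8 * K ^ 4) ≤ 8 * K ^ 5 := by
    calc _ ≤ K * (8 * K ^ 4) := Nat.mul_le_mul_right _ a2
      _ = _ := by ring
  have c5 := Nat.mul_le_mul_left δ₂ a5
  have c6 := Nat.mul_le_mul_left δ₂ a6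
  have d5 := Nat.mul_le_mul_left δ₁ b5
  have d6 := Nat.mul_le_mul_left δ₁ b6
  zify at *
  rw [abs_le]
  constructor <;> nlinarith

/-- Outside of the belts, configurations one of which is close to an exceptional configuration can
be told apart. -/
theorem not_eqv_of_not_good {K : ℕ} (hK : Fintype.card M.Q ≤ K) (hK2 : 2 ≤ K) {t : ℕ}
    {c d : M.Q × ℕ} (hg : ¬ Good K c.2 d.2) (h : M.DistLe K t c ∨ M.DistLe K t d) :
    ¬ M.Eqv (K + 1 + t) (.inl c) (.inl d) := by
  intro he
  have key : ∀ {c d : M.Q × ℕ} {t' : ℕ}, t' ≤ t → M.Eqv (K + 1 + t) (.inl c) (.inl d) →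
      M.DistLe K t' c → M.DistLe K t' d := by
    rintro c d t' ht' he ⟨u, hu, hu'⟩
    refine ⟨u, hu, fun s hs => hu' s ?_⟩
    exact (Eqv.crun (he.mono (by omega))).trans hs
  have hboth : M.DistLe K t c ∧ M.DistLe K t d :=
    h.elim (fun h => ⟨h, key le_rfl he h⟩) (fun h => ⟨key le_rfl he.symm h, h⟩)
  obtain ⟨t₁, a1, a2, a3⟩ := exists_min_distLe hboth.1
  obtain ⟨t₂, b1, b2, b3⟩ := exists_min_distLe hboth.2
  have hle : ∀ {c d : M.Q × ℕ} {t₁ t₂ : ℕ}, t₁ ≤ t → M.Eqv (K + 1 + t) (.inl c) (.inl d) →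
      M.DistLe K t₁ c → (∀ u : List A, M.Exc K (M.crun d u) → t₂ ≤ u.length) → t₂ ≤ t₁ := by
    intro c d t₁ t₂ h1 h2 h3 h4
    obtain ⟨u, hu, hu'⟩ := key h1 h2 h3
    exact (h4 u hu').trans hu
  obtain rfl : t₁ = t₂ := le_antisymm (hle b1 he.symm b2 a3) (hle a1 he a2 b3)
  exact hg (good_of_dist_eq hK hK2 a2 a3 b2 b3)

end DWROCA

/-- Pigeonhole principle on an interval of natural numbers. -/
theorem exists_lt_map_eq_of_card_lt {κ : Type*} {a b n : ℕ} (s : Finset κ) (hs : s.card ≤ n)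
    (hab : a + n < b) (f : ℕ → κ) (hf : ∀ j, a ≤ j → j < b → f j ∈ s) :
    ∃ j j', a ≤ j ∧ j < j' ∧ j' < b ∧ f j = f j' := by
  classical
  obtain ⟨i, hi, j, hj, hij, he⟩ := Finset.exists_ne_map_eq_of_card_lt_of_maps_to
    (s := Finset.Ico a b) (t := s) (by rw [Nat.card_Ico]; omega) (f := f)
    (fun j hj => hf j (Finset.mem_Ico.1 hj).1 (Finset.mem_Ico.1 hj).2)
  rw [Finset.mem_Ico] at hi hj
  rcases Nat.lt_or_gt_of_ne hij with h | h
  · exact ⟨i, j, hi.1, h, hj.2, he⟩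
  · exact ⟨j, i, hj.1, h, hi.2, he.symm⟩

theorem le_add_of_mul_le_mul_add {b s t z : ℤ} (hb : 1 ≤ b) (hz : 0 ≤ z)
    (h : b * s ≤ b * t + z) : s ≤ t + z := by
  by_contra! hlt
  nlinarith

namespace DWROCA

variable {M : DWROCA A S}

/-! ### Runs of minimal witnesses -/

/-- The word `w` is a shortest word telling apart `x` and `y`, in terms of the configuration pairs
on runs from `(x, y)`. -/
structure MinRun (M : DWROCA A S) (x y : M.Q × ℕ) (w : List A) : Prop where
  fst_zero : x.2 = 0
  snd_zero : y.2 = 0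
  eqv : ∀ u : List A, u.length < w.length →
    M.Eqv (w.length - 1 - u.length) (.inl (M.crun x u)) (.inl (M.crun y u))
  not_eqv : ∀ i < w.length,
    ¬ M.Eqv (w.length - i) (.inl (M.crun x (w.take i))) (.inl (M.crun y (w.take i)))

theorem MinRun.symm {x y : M.Q × ℕ} {w : List A} (h : M.MinRun x y w) : M.MinRun y x w :=
  ⟨h.snd_zero, h.fst_zero, fun u hu => (h.eqv u hu).symm, fun i hi he => h.not_eqv i hi he.symm⟩

theorem MinRun.eqv_take {x y : M.Q × ℕ} {w : List A} (h : M.MinRun x y w) {i : ℕ}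
    (hi : i < w.length) :
    M.Eqv (w.length - 1 - i) (.inl (M.crun x (w.take i))) (.inl (M.crun y (w.take i))) := by
  have := h.eqv (w.take i) (by rw [List.length_take]; omega)
  rwa [List.length_take, min_eq_left hi.le] at this

/-- Only a short part of the run of a minimal witness is left once it is outside of the belts. -/
theorem MinRun.length_le {K : ℕ} (hK : Fintype.card M.Q ≤ K) (hK2 : 2 ≤ K) {x y : M.Q × ℕ}
    {w : List A} (h : M.MinRun x y w) {i Z : ℕ} (hi : i < w.length) (hZ : K ≤ Z)
    (hm : (M.crun x (w.take i)).2 ≤ Z) (hn : (M.crun y (w.take i)).2 ≤ Z)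
    (hg : ¬ Good K (M.crun x (w.take i)).2 (M.crun y (w.take i)).2) :
    w.length ≤ i + (K + 1 + K * (Z + K ^ 2 + 1)) := by
  by_contra hcon
  have he := h.eqv_take hi
  have hd : M.DistLe K (K * (Z + K ^ 2 + 1)) (M.crun x (w.take i)) ∨
      M.DistLe K (K * (Z + K ^ 2 + 1)) (M.crun y (w.take i)) := by
    by_contra! hno
    have key : ∀ c : M.Q × ℕ, c.2 ≤ Z → ¬ M.DistLe K (K * (Z + K ^ 2 + 1)) c →
        ¬ M.DistLe K (w.length - i - (K + 1)) c := fun c hc hn h' =>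
      hn ((h'.bound hK).mono (Nat.mul_le_mul_left _ (by omega)))
    have := eqv_of_not_distLe hK (key _ hm hno.1) (key _ hn hno.2) (he.mono (by omega))
    exact h.not_eqv i hi (this.mono (by omega))
  exact not_eqv_of_not_good hK hK2 hg hd (he.mono (by omega))

/-- A colouring of pairs of levels such that lowering the counters between two pairs of the same
colour preserves inequivalence. -/
theorem exists_shift_not_eqv {K : ℕ} (hK : Fintype.card M.Q ≤ K) (hK2 : 2 ≤ K) {t : ℕ}
    {c d : M.Q × ℕ} (he : M.Eqv (t - 1) (.inl c) (.inl d)) (hne : ¬ M.Eqv t (.inl c) (.inl d)) :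
    ∃ r : ℕ → ℕ → M.Q, ∀ j j' n n', K + 1 ≤ j → j < j' → j' ≤ c.2 → K + 1 ≤ n → n < n' →
      n' ≤ d.2 → r j n = r j' n' → (t ≤ K + 1 ∨ ¬ Good K (c.2 - (j' - j)) (d.2 - (n' - n))) →
      ¬ M.Eqv t (.inl (c.1, c.2 - (j' - j))) (.inl (d.1, d.2 - (n' - n))) := by
  rcases Nat.lt_or_ge (K + 1) t with ht | ht
  · have hd : M.DistLe K (t - (K + 1)) c ∨ M.DistLe K (t - (K + 1)) d := by
      by_contra! hno
      exact hne ((eqv_of_not_distLe hK hno.1 hno.2 (he.mono (by omega))).mono (by omega))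
    have et : t = K + 1 + (t - (K + 1)) := by omega
    rcases hd with hd | hd
    · obtain ⟨r, hr⟩ := hd.exists_shift
      refine ⟨fun j _ => r j, fun j j' n n' h1 h2 h3 _ _ _ h7 h8 => ?_⟩
      rw [et]
      exact not_eqv_of_not_good hK hK2 (h8.resolve_left (by omega))
        (.inl (hr j j' (by omega) h2 h3 h7))
    · obtain ⟨r, hr⟩ := hd.exists_shift
      refine ⟨fun _ n => r n, fun j j' n n' _ _ _ h4 h5 h6 h7 h8 => ?_⟩
      rw [et]
      exact not_eqv_of_not_good hK hK2 (h8.resolve_left (by omega))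
        (.inr (hr n n' (by omega) h5 h6 h7))
  · refine ⟨fun _ _ => M.q0, fun j j' n n' h1 h2 h3 h4 h5 h6 _ _ hcon => hne ?_⟩
    have hc := eqv_state (M := M) (k := t) (c := c) (by omega)
    have hd := eqv_state (M := M) (k := t) (c := d) (by omega)
    have hc' := eqv_state (M := M) (k := t) (c := (c.1, c.2 - (j' - j))) (by simp only; omega)
    have hd' := eqv_state (M := M) (k := t) (c := (d.1, d.2 - (n' - n))) (by simp only; omega)
    exact (hc.trans hc'.symm).trans (hcon.trans (hd'.trans hd.symm))

/-- The run of a minimal witness does not climb high inside a belt. -/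
theorem MinRun.ascent_le {K : ℕ} (hK : Fintype.card M.Q ≤ K) (hK2 : 2 ≤ K) {x y : M.Q × ℕ}
    {w : List A} (h : M.MinRun x y w) {m n : ℕ → ℕ} (hm : ∀ i, m i = (M.crun x (w.take i)).2)
    (hn : ∀ i, n i = (M.crun y (w.take i)).2) {a k α β D : ℕ} (hak : a ≤ k) (hk : k < w.length)
    (hα : 1 ≤ α) (hβ : 1 ≤ β)
    (hbelt : ∀ l, a ≤ l → l ≤ k → |(α : ℤ) * m l - β * n l| ≤ D) (hma : K + 1 ≤ m a)
    (hna : 2 * D + K + 1 ≤ n a)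
    (hend : w.length - k ≤ K + 1 ∨ ∀ m' n' : ℕ, m a ≤ m' → n a ≤ n' →
      (α : ℤ) * m' - β * n' = α * m k - β * n k → ¬ Good K m' n') :
    m k ≤ m a + K ^ 3 * (2 * D + 1) + 2 * D := by
  classical
  by_contra hcon
  have hu : ∀ j, ∃ u, m a ≤ j → j ≤ m k → a ≤ u ∧ u ≤ k ∧ m u = j ∧
      ∀ l, u < l → l ≤ k → j < m l := by
    intro j
    by_cases hj : m a ≤ j ∧ j ≤ m k
    · obtain ⟨u, hu⟩ := exists_last_ascent (f := m)
        (fun i => by simpa only [hm] using crun_snd_lipschitz x w i) hak hj.1 hj.2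
      exact ⟨u, fun _ _ => hu⟩
    · exact ⟨0, fun h1 h2 => absurd ⟨h1, h2⟩ hj⟩
  choose u hu using hu
  obtain ⟨r, hr⟩ := exists_shift_not_eqv hK hK2 (t := w.length - k)
    (c := M.crun x (w.take k)) (d := M.crun y (w.take k))
    ((h.eqv_take hk).mono (by omega)) (h.not_eqv k hk)
  simp only [← hm, ← hn] at hr
  obtain ⟨j, j', h1, h2, h3, h4⟩ := exists_lt_map_eq_of_card_lt (a := m a) (b := m k - 2 * D)
    (n := K ^ 3 * (2 * D + 1))
    ((Finset.univ : Finset (M.Q × M.Q × M.Q)) ×ˢ Finset.Icc (-(D : ℤ)) D)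
    (by
      rw [Finset.card_product, Finset.card_univ, Fintype.card_prod, Fintype.card_prod,
        Int.card_Icc]
      refine Nat.mul_le_mul ?_ (by omega)
      calc _ ≤ K * (K * K) := Nat.mul_le_mul hK (Nat.mul_le_mul hK hK)
        _ = _ := by ring)
    (by omega)
    (fun j => (((M.crun x (w.take (u j))).1, (M.crun y (w.take (u j))).1, r j (n (u j))),
      (α : ℤ) * j - β * n (u j)))
    (fun j hj hj' => by
      obtain ⟨u1, u2, u3, -⟩ := hu j hj (by omega)
      have := hbelt _ u1 u2
      rw [u3] at this
      simpa [Finset.mem_Icc] using abs_le.1 this)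
  simp only [Prod.mk.injEq] at h4
  obtain ⟨⟨e1, e2, e3⟩, e4⟩ := h4
  obtain ⟨u1, u2, u3, u4⟩ := hu j h1 (by omega)
  obtain ⟨v1, v2, v3, v4⟩ := hu j' (by omega) (by omega)
  have huv : u j < u j' := by
    rcases Nat.lt_trichotomy (u j) (u j') with h' | h' | h'
    · exact h'
    · rw [h'] at u3; omega
    · have := v4 (u j) h' u2; omega
  have hba := abs_le.1 (hbelt a le_rfl hak)
  have hbk := abs_le.1 (hbelt k hak le_rfl)
  have hbu := abs_le.1 (hbelt _ u1 u2)
  have hbv := abs_le.1 (hbelt _ v1 v2)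
  rw [u3] at hbu
  rw [v3] at hbv
  have hα' : (1 : ℤ) ≤ α := by exact_mod_cast hα
  have hβ' : (1 : ℤ) ≤ β := by exact_mod_cast hβ
  have cmp := fun s t z : ℤ => le_add_of_mul_le_mul_add hβ' (s := s) (t := t) (z := z)
  have hjj : (α : ℤ) * j ≤ α * j' := mul_le_mul_of_nonneg_left (by omega) (by omega)
  have hja : (α : ℤ) * m a ≤ α * j := mul_le_mul_of_nonneg_left (by omega) (by omega)
  have hjk : (α : ℤ) * j' + 2 * D ≤ α * m k := by
    have h5 : (α : ℤ) * (j' + 2 * D) ≤ α * m k :=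
      mul_le_mul_of_nonneg_left (by omega) (by omega)
    have h6 : (2 * D : ℤ) ≤ α * (2 * D) := le_mul_of_one_le_left (by omega) hα'
    linarith
  have hY : n (u j) < n (u j') := by
    by_contra! hle
    have : (β : ℤ) * n (u j') ≤ β * n (u j) := mul_le_mul_of_nonneg_left (by omega) (by omega)
    have : (α : ℤ) * (j' - j) ≤ 0 := by linarith
    have : (0 : ℤ) < α * (j' - j) := mul_pos (by omega) (by omega)
    linarith
  have hnu : n a ≤ n (u j) + 2 * D := by
    have := cmp (n a) (n (u j)) (2 * D) (by omega) (by linarith)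
    omega
  have hnk : n (u j') ≤ n k := by
    have := cmp (n (u j')) (n k) 0 le_rfl (by linarith)
    omega
  have hnak : n a ≤ n k - (n (u j') - n (u j)) := by
    have := cmp (n a) (n k - (n (u j') - n (u j))) 0 le_rfl (by
      have : (2 : ℤ) * D ≤ α * m k - α * j' := by linarith
      linarith)
    omega
  refine hr j j' _ _ (by omega) h2 (by omega) (by omega) hY hnk e3
    (hend.imp_right fun hend => ?_) ?_
  · refine hend _ _ (by omega) hnak ?_
    rw [Nat.cast_sub (by omega), Nat.cast_sub (by omega), Nat.cast_sub (by omega),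
      Nat.cast_sub hY.le]
    linarith
  · have hx := crun_segment (M := M) x w v2
    have hy := crun_segment (M := M) y w v2
    obtain ⟨s1, s2, -⟩ := crun_shift (M := M) (x := (j : ℤ) - j') (h := j') (h' := j)
      (c := M.crun x (w.take (u j'))) (c' := M.crun x (w.take (u j)))
      (u := (w.take k).drop (u j')) (by omega) (by omega) (by omega) e1
      (by rw [← hm, ← hm, u3, v3]; ring)
      (above_segment fun l hl hl' => by
        rw [← hm]
        rcases hl.eq_or_lt with rfl | hl
        · exact v3.ge
        · exact (v4 l hl hl'.le).le)
    obtain ⟨t1, t2, -⟩ := crun_shift (M := M) (x := (n (u j) : ℤ) - n (u j'))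
      (h := n (u j') - n (u j) + 1) (h' := 1)
      (c := M.crun y (w.take (u j'))) (c' := M.crun y (w.take (u j)))
      (u := (w.take k).drop (u j')) (by omega) (by omega) (by omega) e2
      (by rw [← hn, ← hn]; ring)
      (above_segment fun l hl hl' => by
        rw [← hn]
        have hbl := abs_le.1 (hbelt l (by omega) hl'.le)
        have hml : j' ≤ m l := by
          rcases hl.eq_or_lt with rfl | hl
          · exact v3.ge
          · exact (v4 l hl hl'.le).le
        have : (α : ℤ) * j' ≤ α * m l := mul_le_mul_of_nonneg_left (by omega) (by omega)
        have := cmp (n (u j') + n a) (n l + n (u j)) (2 * D) (by omega) (by linarith)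
        omega)
    rw [hx] at s1 s2
    rw [hy] at t1 t2
    rw [← hm] at s2
    rw [← hn] at t2
    have hcut := h.eqv (w.take (u j) ++ (w.take k).drop (u j')) (by simp; omega)
    rw [crun_append, crun_append,
      show M.crun (M.crun x (w.take (u j))) ((w.take k).drop (u j')) =
        ((M.crun x (w.take k)).1, m k - (j' - j)) from Prod.ext s1 (by omega),
      show M.crun (M.crun y (w.take (u j))) ((w.take k).drop (u j')) =
        ((M.crun y (w.take k)).1, n k - (n (u j') - n (u j))) from Prod.ext t1 (by omega)] at hcut
    exact hcut.mono (by simp; omega)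

/-- The run of a minimal witness has no high peaks inside a belt. -/
theorem MinRun.peak_le {K : ℕ} (hK : Fintype.card M.Q ≤ K) {x y : M.Q × ℕ}
    {w : List A} (h : M.MinRun x y w) {m n : ℕ → ℕ} (hm : ∀ i, m i = (M.crun x (w.take i)).2)
    (hn : ∀ i, n i = (M.crun y (w.take i)).2) {a e i α β D : ℕ} (hai : a ≤ i) (hie : i ≤ e)
    (he : e < w.length) (hβ : 1 ≤ β)
    (hbelt : ∀ l, a ≤ l → l ≤ e → |(α : ℤ) * m l - β * n l| ≤ D)
    (hnl : ∀ l, a ≤ l → l ≤ e → 2 * D + 1 ≤ n l) (hma : 1 ≤ m a) :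
    m i ≤ max (m a) (m e) + K ^ 4 * (4 * D + 1) := by
  classical
  by_contra hcon
  have hlip : ∀ i, m (i + 1) ≤ m i + 1 ∧ m i ≤ m (i + 1) + 1 :=
    fun i => by simpa only [hm] using crun_snd_lipschitz x w i
  have hu : ∀ j, ∃ u, max (m a) (m e) ≤ j → j ≤ m i → a ≤ u ∧ u ≤ i ∧ m u = j ∧
      ∀ l, u < l → l ≤ i → j < m l := by
    intro j
    by_cases hj : max (m a) (m e) ≤ j ∧ j ≤ m i
    · obtain ⟨u, hu⟩ := exists_last_ascent hlip hai (le_of_max_le_left hj.1) hj.2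
      exact ⟨u, fun _ _ => hu⟩
    · exact ⟨0, fun h1 h2 => absurd ⟨h1, h2⟩ hj⟩
  have hv : ∀ j, ∃ v, max (m a) (m e) ≤ j → j ≤ m i → i ≤ v ∧ v ≤ e ∧ m v = j ∧
      ∀ l, i ≤ l → l < v → j < m l := by
    intro j
    by_cases hj : max (m a) (m e) ≤ j ∧ j ≤ m i
    · obtain ⟨u, hu⟩ := exists_first_descent hlip hie (le_of_max_le_right hj.1) hj.2
      exact ⟨u, fun _ _ => hu⟩
    · exact ⟨0, fun h1 h2 => absurd ⟨h1, h2⟩ hj⟩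
  choose u hu using hu
  choose v hv using hv
  have hβ' : (1 : ℤ) ≤ β := by exact_mod_cast hβ
  have cmp := fun s t z : ℤ => le_add_of_mul_le_mul_add hβ' (s := s) (t := t) (z := z)
  obtain ⟨j, j', h1, h2, h3, h4⟩ := exists_lt_map_eq_of_card_lt (a := max (m a) (m e)) (b := m i)
    (n := K ^ 4 * (4 * D + 1))
    ((Finset.univ : Finset ((M.Q × M.Q) × M.Q × M.Q)) ×ˢ Finset.Icc (-(2 * D : ℤ)) (2 * D))
    (by
      rw [Finset.card_product, Finset.card_univ, Fintype.card_prod, Fintype.card_prod,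
        Int.card_Icc]
      refine Nat.mul_le_mul ?_ (by omega)
      calc _ ≤ (K * K) * (K * K) := Nat.mul_le_mul (Nat.mul_le_mul hK hK) (Nat.mul_le_mul hK hK)
        _ = _ := by ring)
    (by omega)
    (fun j => ((((M.crun x (w.take (u j))).1, (M.crun y (w.take (u j))).1),
      ((M.crun x (w.take (v j))).1, (M.crun y (w.take (v j))).1)),
      (n (u j) : ℤ) - n (v j)))
    (fun j hj hj' => by
      obtain ⟨u1, u2, u3, -⟩ := hu j hj (by omega)
      obtain ⟨v1, v2, v3, -⟩ := hv j hj (by omega)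
      have hbu := abs_le.1 (hbelt (u j) u1 (by omega))
      have hbv := abs_le.1 (hbelt (v j) (by omega) v2)
      rw [u3] at hbu
      rw [v3] at hbv
      have c1 := cmp (n (u j)) (n (v j)) (2 * D) (by omega) (by linarith)
      have c2 := cmp (n (v j)) (n (u j)) (2 * D) (by omega) (by linarith)
      simp only [Finset.mem_product, Finset.mem_univ, Finset.mem_Icc, true_and]
      omega)
  simp only [Prod.mk.injEq] at h4
  obtain ⟨⟨⟨e1, e2⟩, e3, e4⟩, e5⟩ := h4
  obtain ⟨u1, u2, u3, u4⟩ := hu j h1 (by omega)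
  obtain ⟨u1', u2', u3', u4'⟩ := hu j' (by omega) (by omega)
  obtain ⟨v1, v2, v3, v4⟩ := hv j h1 (by omega)
  obtain ⟨v1', v2', v3', v4'⟩ := hv j' (by omega) (by omega)
  have huu : u j < u j' := by
    rcases Nat.lt_trichotomy (u j) (u j') with h' | h' | h'
    · exact h'
    · rw [h'] at u3; omega
    · have := u4' (u j) h' u2; omega
  have hvv : v j' ≤ v j := by
    by_contra! hlt
    have := v4' (v j) v1 hlt
    omega
  have hml : ∀ l, u j' ≤ l → l < v j' → j' ≤ m l := by
    intro l hl hl'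
    rcases hl.eq_or_lt with rfl | hl
    · exact u3'.ge
    · rcases Nat.le_total l i with hli | hli
      · exact (u4' l hl hli).le
      · exact (v4' l hli hl').le
  have huv : u j' ≤ v j' := by omega
  obtain ⟨s1, s2, -⟩ := crun_shift (M := M) (x := (j : ℤ) - j') (h := j') (h' := j)
    (c := M.crun x (w.take (u j'))) (c' := M.crun x (w.take (u j)))
    (u := (w.take (v j')).drop (u j')) (by omega) (by omega) (by omega) e1
    (by rw [← hm, ← hm, u3, u3']; ring)
    (above_segment fun l hl hl' => by rw [← hm]; exact hml l hl hl')
  have hpos := hnl (u j') u1' (by omega)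
  have hpos' := hnl (u j) u1 (by omega)
  obtain ⟨t1, t2, -⟩ := crun_shift (M := M) (x := (n (u j) : ℤ) - n (u j'))
    (h := max 1 (n (u j') - 2 * D)) (h' := 1)
    (c := M.crun y (w.take (u j'))) (c' := M.crun y (w.take (u j)))
    (u := (w.take (v j')).drop (u j')) (by omega) (by omega) (by omega) e2
    (by rw [← hn, ← hn]; ring)
    (above_segment fun l hl hl' => by
      rw [← hn]
      have hbl := abs_le.1 (hbelt l (by omega) (by omega))
      have hbu := abs_le.1 (hbelt (u j') u1' (by omega))
      rw [u3'] at hbu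
      have : (α : ℤ) * j' ≤ α * m l :=
        mul_le_mul_of_nonneg_left (by exact_mod_cast hml l hl hl') (by omega)
      have := cmp (n (u j')) (n l) (2 * D) (by omega) (by linarith)
      omega)
  rw [crun_segment x w huv, ← hm] at s2
  rw [crun_segment x w huv] at s1
  rw [crun_segment y w huv, ← hn] at t2
  rw [crun_segment y w huv] at t1
  have hcut := h.eqv (w.take (u j) ++ (w.take (v j')).drop (u j')) (by simp; omega)
  rw [crun_append, crun_append,
    show M.crun (M.crun x (w.take (u j))) ((w.take (v j')).drop (u j')) =
      M.crun x (w.take (v j)) from Prod.ext (s1.trans e3.symm) (by rw [← hm]; omega),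
    show M.crun (M.crun y (w.take (u j))) ((w.take (v j')).drop (u j')) =
      M.crun y (w.take (v j)) from Prod.ext (t1.trans e4.symm) (by rw [← hn]; omega)] at hcut
  exact h.not_eqv (v j) (by omega) (hcut.mono (by simp; omega))

end DWROCA

theorem exists_maximal_interval {P : ℕ → Prop} {a n : ℕ} (han : a ≤ n) (ha : P a) :
    ∃ e, a ≤ e ∧ e ≤ n ∧ (∀ l, a ≤ l → l ≤ e → P l) ∧ (e = n ∨ ¬ P (e + 1)) := by
  induction n, han using Nat.le_induction with
  | base => exact ⟨a, le_rfl, le_rfl, fun l h h' => by rwa [le_antisymm h' h], .inl rfl⟩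
  | succ n han ih =>
    obtain ⟨e, h1, h2, h3, h4⟩ := ih
    rcases h4 with rfl | h4
    · by_cases hP : P (e + 1)
      · refine ⟨e + 1, by omega, le_rfl, fun l hl hl' => ?_, .inl rfl⟩
        rcases Nat.le_succ_iff.1 hl' with h | rfl
        · exact h3 l hl h
        · exact hP
      · exact ⟨e, h1, by omega, h3, .inr hP⟩
    · exact ⟨e, h1, by omega, h3, .inr h4⟩

namespace DWROCA

variable {M : DWROCA A S}

/-! ### The bound on the counter values -/

/-- Belts of different slopes meet only near the origin. -/
theorem IsSlope.eq_or_le {K α β α' β' m n : ℕ} (h : IsSlope K α β) (h' : IsSlope K α' β')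
    (hb : |(α : ℤ) * m - β * n| ≤ 18 * K ^ 5) (hb' : |(α' : ℤ) * m - β' * n| ≤ 18 * K ^ 5) :
    (α = α' ∧ β = β') ∨ (m ≤ 72 * K ^ 9 ∧ n ≤ 72 * K ^ 9) := by
  obtain ⟨a1, a2, b1, b2, hco⟩ := h
  obtain ⟨a1', a2', b1', b2', hco'⟩ := h'
  by_cases hdet : α * β' = α' * β
  · left
    have e1 : α = α' := Nat.dvd_antisymm (hco.dvd_of_dvd_mul_right ⟨β', hdet.symm⟩)
      (hco'.dvd_of_dvd_mul_right ⟨β, hdet⟩)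
    subst e1
    exact ⟨rfl, (Nat.eq_of_mul_eq_mul_left a1 hdet).symm⟩
  · right
    have hdet' : (1 : ℤ) ≤ |(α : ℤ) * β' - α' * β| :=
      Int.one_le_abs (sub_ne_zero.2 (by exact_mod_cast hdet))
    have key : ∀ z s s' v v' : ℤ, |v| ≤ 18 * (K : ℤ) ^ 5 → |v'| ≤ 18 * (K : ℤ) ^ 5 → 0 ≤ s →
        s ≤ 2 * (K : ℤ) ^ 4 → 0 ≤ s' → s' ≤ 2 * (K : ℤ) ^ 4 →
        z * ((α : ℤ) * β' - α' * β) = s * v - s' * v' → z ≤ 72 * (K : ℤ) ^ 9 := by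
      intro z s s' v v' hv hv' hs0 hs hs0' hs' he
      calc z ≤ |z| := le_abs_self z
        _ ≤ |z| * |(α : ℤ) * β' - α' * β| := le_mul_of_one_le_right (abs_nonneg _) hdet'
        _ = |s * v - s' * v'| := by rw [← abs_mul, he]
        _ ≤ |s * v| + |s' * v'| := abs_sub _ _
        _ = s * |v| + s' * |v'| := by rw [abs_mul, abs_mul, abs_of_nonneg hs0, abs_of_nonneg hs0']
        _ ≤ 2 * (K : ℤ) ^ 4 * (18 * (K : ℤ) ^ 5) + 2 * (K : ℤ) ^ 4 * (18 * (K : ℤ) ^ 5) := by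
          gcongr
        _ = _ := by ring
    constructor
    · have := key m β' β _ _ hb hb' (by omega) (by exact_mod_cast b2') (by omega)
        (by exact_mod_cast b2) (by ring)
      exact_mod_cast this
    · have := key n α' α _ _ hb hb' (by omega) (by exact_mod_cast a2') (by omega)
        (by exact_mod_cast a2) (by ring)
      exact_mod_cast this

theorem crun_snd_take_add_le (c : M.Q × ℕ) (u : List A) (i j : ℕ) :
    (M.crun c (u.take (i + j))).2 ≤ (M.crun c (u.take i)).2 + j := by
  induction j with
  | zero => simp
  | succ j ih =>
    have := (crun_snd_lipschitz c u (i + j)).1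
    rw [← add_assoc]
    omega

/-- Far from the origin, both counter values of a pair in a belt are large. -/
theorem IsSlope.le_of_lt {K α β m n : ℕ} (hK2 : 2 ≤ K) (h : IsSlope K α β)
    (hb : |(α : ℤ) * m - β * n| ≤ 18 * K ^ 5) (hm : 82 * K ^ 9 < m ∨ 82 * K ^ 9 < n) :
    40 * K ^ 5 ≤ m ∧ 40 * K ^ 5 ≤ n := by
  obtain ⟨a1, a2, b1, b2, -⟩ := h
  have hK5 : 1 ≤ K ^ 5 := Nat.one_le_pow _ _ (by omega)
  have hK4 : 16 ≤ K ^ 4 := Nat.pow_le_pow_left hK2 4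
  have hK9 : K ^ 9 = K ^ 4 * K ^ 5 := by ring
  have key : ∀ {α β m n : ℕ}, 1 ≤ α → β ≤ 2 * K ^ 4 → (α : ℤ) * m ≤ β * n + 18 * K ^ 5 →
      82 * K ^ 9 < m → 40 * K ^ 5 ≤ m ∧ 40 * K ^ 5 ≤ n := by
    intro α β m n hα hβ hle hm
    have hle' : α * m ≤ β * n + 18 * K ^ 5 := by exact_mod_cast hle
    have h1 : m ≤ α * m := Nat.le_mul_of_pos_left _ hα
    have h2 : β * n ≤ 2 * K ^ 4 * n := Nat.mul_le_mul_right _ hβ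
    refine ⟨by nlinarith, ?_⟩
    by_contra! hlt
    have h3 : 2 * K ^ 4 * n ≤ 2 * K ^ 4 * (40 * K ^ 5) := Nat.mul_le_mul_left _ hlt.le
    nlinarith
  obtain ⟨hb1, hb2⟩ := abs_le.1 hb
  rcases hm with hm | hm
  · exact key a1 b2 (by linarith) hm
  · exact (key b1 a2 (by linarith) hm).symm

/-- The counter values on the run of a minimal witness are bounded. -/
theorem MinRun.fst_le {K : ℕ} (hK : Fintype.card M.Q ≤ K) (hK2 : 2 ≤ K) {x y : M.Q × ℕ}
    {w : List A} (h : M.MinRun x y w) {i : ℕ} (hi : i < w.length) :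
    (M.crun x (w.take i)).2 ≤ 250 * K ^ 10 := by
  classical
  obtain ⟨m, hm⟩ : ∃ m : ℕ → ℕ, ∀ i, m i = (M.crun x (w.take i)).2 := ⟨_, fun _ => rfl⟩
  obtain ⟨n, hn⟩ : ∃ n : ℕ → ℕ, ∀ i, n i = (M.crun y (w.take i)).2 := ⟨_, fun _ => rfl⟩
  rw [← hm]
  have hm1 : ∀ i, m (i + 1) ≤ m i + 1 ∧ m i ≤ m (i + 1) + 1 :=
    fun i => by simpa only [hm] using crun_snd_lipschitz x w i
  have hn1 : ∀ i, n (i + 1) ≤ n i + 1 ∧ n i ≤ n (i + 1) + 1 :=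
    fun i => by simpa only [hn] using crun_snd_lipschitz y w i
  set H := 82 * K ^ 9 with hH
  set D := 18 * K ^ 5 with hD
  -- numerical facts
  have p1 : K ^ 2 ≤ K ^ 9 := Nat.pow_le_pow_right (by omega) (by omega)
  have p2 : 512 ≤ K ^ 9 := Nat.pow_le_pow_left hK2 9
  have p3 : 2 * K ^ 9 ≤ K ^ 10 := by
    rw [pow_succ K 9, mul_comm]; exact Nat.mul_le_mul_left _ hK2
  have p4 : K ≤ K ^ 2 := Nat.le_self_pow (by omega) K
  have p5 : 2 * K ^ 4 ≤ K ^ 5 := by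
    rw [pow_succ K 4, mul_comm]; exact Nat.mul_le_mul_left _ hK2
  have p6 : K ^ 4 * (4 * D + 1) ≤ 73 * K ^ 9 := by
    have : K ^ 4 ≤ K ^ 9 := Nat.pow_le_pow_right (by omega) (by omega)
    calc K ^ 4 * (4 * D + 1) = 72 * K ^ 9 + K ^ 4 := by rw [hD]; ring
      _ ≤ _ := by omega
  have p7 : K ^ 3 * (2 * D + 1) + 2 * D ≤ 21 * K ^ 9 := by
    have e9 : K ^ 9 = K * K ^ 8 := by ring
    have e8 : K ^ 8 = K ^ 3 * K ^ 5 := by ring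
    have q1 : 8 ≤ K ^ 3 := Nat.pow_le_pow_left hK2 3
    have q2 : 8 * K ^ 5 ≤ K ^ 8 := by rw [e8]; exact Nat.mul_le_mul_right _ q1
    have q3 : K ^ 3 ≤ K ^ 5 := Nat.pow_le_pow_right (by omega) (by omega)
    have q4 : 2 * K ^ 8 ≤ K ^ 9 := by rw [e9]; exact Nat.mul_le_mul_right _ hK2
    calc K ^ 3 * (2 * D + 1) + 2 * D = 36 * K ^ 8 + K ^ 3 + 36 * K ^ 5 := by rw [hD]; ring
      _ ≤ _ := by omega
  have p8 : K ≤ K ^ 5 := Nat.le_self_pow (by omega) K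
  have p9 : ∀ Z, Z ≤ 104 * K ^ 9 → Z + (K + 1 + K * (Z + K ^ 2 + 1)) ≤ 250 * K ^ 10 := by
    intro Z hZ
    have q1 : K * (Z + K ^ 2 + 1) ≤ K * (105 * K ^ 9 + K ^ 9) := Nat.mul_le_mul_left _ (by omega)
    have q2 : K * (105 * K ^ 9 + K ^ 9) = 106 * K ^ 10 := by ring
    omega
  by_contra hcon
  have hmi : H < m i := by omega
  -- the last time at which both counters are small
  set P : ℕ → Prop := fun l => m l ≤ H ∧ n l ≤ H with hP
  have hP0 : P 0 := by simp [hP, hm, hn, h.fst_zero, h.snd_zero]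
  set a := Nat.findGreatest P i with ha
  have haP : P a := Nat.findGreatest_spec (Nat.zero_le i) hP0
  have hai : a < i := by
    refine lt_of_le_of_ne (Nat.findGreatest_le i) fun he => ?_
    rw [he] at haP
    exact absurd haP.1 (by omega)
  have hlarge : ∀ l, a + 1 ≤ l → l ≤ i → H < m l ∨ H < n l := by
    intro l hl hl'
    have : ¬ P l := Nat.findGreatest_is_greatest (ha ▸ hl) hl'
    simp only [hP] at this
    omega
  have ha1 := hm1 a
  have ha2 := hn1 a
  obtain ⟨haP1, haP2⟩ := haP
  -- the end of the run once it has left the belts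
  have hoff : ∀ k Z, k ≤ i → K ≤ Z → m k ≤ Z → n k ≤ Z → ¬ Good K (m k) (n k) →
      m i ≤ Z + (K + 1 + K * (Z + K ^ 2 + 1)) := by
    intro k Z hki hZ hmk hnk hg
    have h1 := h.length_le hK hK2 (i := k) (by omega) hZ (by rwa [← hm]) (by rwa [← hn])
      (by rwa [← hm, ← hn])
    have h2 := crun_snd_take_add_le x w k (i - k)
    rw [Nat.add_sub_cancel' hki, ← hm, ← hm] at h2
    omega
  by_cases hg : Good K (m (a + 1)) (n (a + 1))
  · obtain ⟨α, β, hs, hb⟩ := hg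
    obtain ⟨e, e1, e2, e3, e4⟩ := exists_maximal_interval
      (P := fun l => |(α : ℤ) * m l - β * n l| ≤ 16 * K ^ 5 ∧ (H < m l ∨ H < n l))
      (a := a + 1) (n := w.length - 1) (by omega) ⟨hb, hlarge _ le_rfl hai⟩
    have hwide : ∀ l, a + 1 ≤ l → l ≤ e → |(α : ℤ) * m l - β * n l| ≤ 18 * K ^ 5 := by
      intro l hl hl'
      have := (e3 l hl hl').1
      have : (0 : ℤ) ≤ K ^ 5 := by positivity
      linarith
    have hhigh : ∀ l, a + 1 ≤ l → l ≤ e → 40 * K ^ 5 ≤ m l ∧ 40 * K ^ 5 ≤ n l :=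
      fun l hl hl' => hs.le_of_lt hK2 (hwide l hl hl') (e3 l hl hl').2
    have hstart := hhigh (a + 1) le_rfl e1
    have hascent : ∀ k, a + 1 ≤ k → k < w.length →
        (∀ l, a + 1 ≤ l → l ≤ k → |(α : ℤ) * m l - β * n l| ≤ 18 * K ^ 5) →
        (w.length - k ≤ K + 1 ∨ ∀ m' n' : ℕ, m (a + 1) ≤ m' → n (a + 1) ≤ n' →
          (α : ℤ) * m' - β * n' = α * m k - β * n k → ¬ Good K m' n') →
        m k ≤ 104 * K ^ 9 ∧ n k ≤ 104 * K ^ 9 := by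
      intro k hak hk hbelt hend
      have h1 := h.ascent_le hK hK2 hm hn (D := D) hak hk hs.1 hs.2.2.1
        (fun l hl hl' => by exact_mod_cast hbelt l hl hl') (by omega) (by omega) hend
      have h2 := h.symm.ascent_le hK hK2 hn hm (α := β) (β := α) (D := D) hak hk hs.2.2.1 hs.1
        (fun l hl hl' => by rw [abs_sub_comm]; exact_mod_cast hbelt l hl hl') (by omega) (by omega)
        (hend.imp_right fun hend m' n' hm' hn' he hgood =>
          hend n' m' hn' hm' (by linarith) hgood.symm)
      omega
    have hpeak : i ≤ e → m e ≤ 104 * K ^ 9 + 1 → False := by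
      intro hie hme
      have := h.peak_le hK hm hn (D := D) (a := a + 1) hai hie (by omega) hs.2.2.1
        (fun l hl hl' => by exact_mod_cast hwide l hl hl')
        (fun l hl hl' => by have := (hhigh l hl hl').2; omega) (by omega)
      omega
    rcases e4 with e4 | e4
    · exact hpeak (by omega) (by
        have := hascent e e1 (by omega) hwide (.inl (by omega))
        omega)
    · have hme := hm1 e
      by_cases hmax : H < m (e + 1) ∨ H < n (e + 1)
      · have hnb : ¬ |(α : ℤ) * m (e + 1) - β * n (e + 1)| ≤ 16 * K ^ 5 := fun h' => e4 ⟨h', hmax⟩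
        rcases Nat.lt_or_ge (e + 1) w.length with hlt | hge
        · have hbe : |(α : ℤ) * m (e + 1) - β * n (e + 1)| ≤ 18 * K ^ 5 := by
            have hb0 := abs_le.1 (e3 e e1 le_rfl).1
            have hne := hn1 e
            have hp5 : (2 : ℤ) * K ^ 4 ≤ K ^ 5 := by exact_mod_cast p5
            obtain ⟨a1, a2, b1, b2, -⟩ := hs
            have hα : (α : ℤ) ≤ 2 * K ^ 4 := by exact_mod_cast a2
            have hβ : (β : ℤ) ≤ 2 * K ^ 4 := by exact_mod_cast b2
            have k1 : |(α : ℤ) * ((m (e + 1) : ℤ) - m e)| ≤ α := by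
              rw [abs_mul, Nat.abs_cast]
              exact mul_le_of_le_one_right (by omega) (abs_le.2 (by omega))
            have k2 : |(β : ℤ) * ((n (e + 1) : ℤ) - n e)| ≤ β := by
              rw [abs_mul, Nat.abs_cast]
              exact mul_le_of_le_one_right (by omega) (abs_le.2 (by omega))
            rw [abs_le] at k1 k2 ⊢
            constructor <;> linarith
          have hbad : ∀ m' n' : ℕ, (H < m' ∨ H < n') →
              (α : ℤ) * m' - β * n' = α * m (e + 1) - β * n (e + 1) → ¬ Good K m' n' := by
            rintro m' n' hmn he ⟨α', β', hs', hb'⟩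
            have : (0 : ℤ) ≤ K ^ 5 := by positivity
            rcases hs.eq_or_le hs' (m := m') (n := n') (by rwa [he]) (by linarith) with
              ⟨rfl, rfl⟩ | hle
            · rw [he] at hb'
              exact hnb hb'
            · omega
          have h1 := hascent (e + 1) (by omega) hlt
            (fun l hl hl' => by
              rcases Nat.le_succ_iff.1 hl' with h' | rfl
              · exact hwide l hl h'
              · exact hbe)
            (.inr fun m' n' hm' hn' he => hbad m' n'
              ((hlarge (a + 1) le_rfl hai).imp (fun h => h.trans_le hm') fun h => h.trans_le hn') he)
          rcases Nat.lt_or_ge e i with hei | hei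
          · have h2 := hoff (e + 1) (104 * K ^ 9) hei (by omega) h1.1 h1.2 (hbad _ _ hmax rfl)
            have h3 := p9 _ le_rfl
            omega
          · exact hpeak hei (by omega)
        · exact hpeak (by omega) (by
            have := hascent e e1 (by omega) hwide (.inl (by omega))
            omega)
      · rcases Nat.lt_or_ge e i with hei | hei
        · exact hmax (hlarge (e + 1) (by omega) hei)
        · exact hpeak hei (by omega)
  · have h1 := hoff (a + 1) (104 * K ^ 9) hai (by omega) (by omega) (by omega) hg
    have h2 := p9 _ le_rfl
    omega

end DWROCA

namespace DWROCA

/-! ### The disjoint union of two automata -/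

/-- The disjoint union of two automata; the initial state is that of the first one. -/
def sum (M N : DWROCA A S) : DWROCA A S where
  Q := M.Q ⊕ N.Q
  fin := inferInstance
  q0 := .inl M.q0
  s0 := M.s0
  s0_ne := M.s0_ne
  next q b x := q.elim (fun q => .inl (M.next q b x)) (fun q => .inr (N.next q b x))
  upd q b x := q.elim (fun q => M.upd q b x) (fun q => N.upd q b x)
  wt q b x := q.elim (fun q => M.wt q b x) (fun q => N.wt q b x)
  upd_mem q b x := by cases q <;> simp only [Sum.elim_inl, Sum.elim_inr, upd_mem]
  no_dec_on_zero q x := by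
    cases q <;> simp only [Sum.elim_inl, Sum.elim_inr, ne_eq, no_dec_on_zero, not_false_eq_true]
  wt_ne q b x := by
    cases q <;> simp only [Sum.elim_inl, Sum.elim_inr, ne_eq, wt_ne, not_false_eq_true]

/-- A configuration of the first automaton in the disjoint union. -/
def left (M N : DWROCA A S) (c : M.Cfg) : (M.sum N).Q × ℕ := (.inl c.1, c.2.1)

/-- A configuration of the second automaton in the disjoint union. -/
def right (M N : DWROCA A S) (d : N.Cfg) : (M.sum N).Q × ℕ := (.inr d.1, d.2.1)

variable {M N : DWROCA A S}

theorem crun_left (c : M.Cfg) (u : List A) :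
    (M.sum N).crun (left M N c) u = left M N (M.run c u) := by
  induction u generalizing c with
  | nil => rfl
  | cons x u ih => exact ih (M.step c x)

theorem crun_right (d : N.Cfg) (u : List A) :
    (M.sum N).crun (right M N d) u = right M N (N.run d u) := by
  induction u generalizing d with
  | nil => rfl
  | cons x u ih => exact ih (N.step d x)

theorem val_append (c : M.Cfg) (u v : List A) : M.val c (u ++ v) = M.val (M.run c u) v := by
  simp [val, run]

theorem run_weight_ne {c : M.Cfg} (h : c.2.2 ≠ 0) (u : List A) : (M.run c u).2.2 ≠ 0 := by
  induction u generalizing c with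
  | nil => exact h
  | cons x u ih => exact ih (c := M.step c x) (mul_ne_zero h (M.wt_ne _ _ _))

theorem eqv_of_kEquiv {k : ℕ} {c : M.Cfg} {d : N.Cfg} (hc : c.2.2 ≠ 0) (h : kEquiv M N c d k) :
    (M.sum N).Eqv k (.inl (left M N c)) (.inl (right M N d)) := by
  induction k generalizing c d with
  | zero => trivial
  | succ k ih =>
    intro x
    have h0 : c.2.2 = d.2.2 := h [] (by simp)
    have h1 : c.2.2 * M.wt c.1 (decide (c.2.1 = 0)) x = d.2.2 * N.wt d.1 (decide (d.2.1 = 0)) x :=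
      h [x] (by simp)
    refine ⟨mul_left_cancel₀ hc (h1.trans (by rw [h0]; rfl)), ?_⟩
    exact ih (c := M.step c x) (d := N.step d x) (mul_ne_zero hc (M.wt_ne _ _ _))
      fun u hu => h (x :: u) (by simpa using hu)

theorem kEquiv_of_eqv {k : ℕ} {c : M.Cfg} {d : N.Cfg} (hw : c.2.2 = d.2.2)
    (h : (M.sum N).Eqv k (.inl (left M N c)) (.inl (right M N d))) : kEquiv M N c d k := by
  induction k generalizing c d with
  | zero =>
    intro u hu
    obtain rfl := List.length_eq_zero_iff.1 (Nat.le_zero.1 hu)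
    exact hw
  | succ k ih =>
    rintro (_ | ⟨x, u⟩) hu
    · exact hw
    · have h1 : M.wt c.1 (decide (c.2.1 = 0)) x = N.wt d.1 (decide (d.2.1 = 0)) x := (h x).1
      exact ih (c := M.step c x) (d := N.step d x) (by simp only [step, hw, h1]) (h x).2 u
        (by simpa using hu)

theorem minRun_of_isMinWitness {w : List A} (hw : IsMinWitness M N w) :
    (M.sum N).MinRun (left M N M.init) (right M N N.init) w := by
  have hlt : ∀ u : List A, u.length < w.length → M.val M.init u = N.val N.init u := by
    intro u hu
    by_contra hne
    have := hw.2 u hne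
    omega
  refine ⟨rfl, rfl, fun u hu => ?_, fun i hi he => hw.1 ?_⟩
  · rw [crun_left, crun_right]
    refine eqv_of_kEquiv (run_weight_ne M.s0_ne u) fun v hv => ?_
    rw [← val_append, ← val_append]
    exact hlt _ (by rw [List.length_append]; omega)
  · rw [crun_left, crun_right] at he
    have h1 := kEquiv_of_eqv (hlt (w.take i) (by rw [List.length_take]; omega)) he (w.drop i)
      (by rw [List.length_drop])
    rwa [← val_append, ← val_append, List.take_append_drop] at h1

theorem MinRun.fst_le_of_le {K : ℕ} (hK : Fintype.card M.Q ≤ K) (hK2 : 2 ≤ K) {x y : M.Q × ℕ}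
    {w : List A} (h : M.MinRun x y w) {i : ℕ} (hi : i ≤ w.length) :
    (M.crun x (w.take i)).2 ≤ 250 * K ^ 10 + 1 := by
  rcases i with _ | i
  · simp [h.fst_zero]
  · have h1 := h.fst_le hK hK2 (i := i) (by omega)
    have h2 := (crun_snd_lipschitz x w i).1
    omega

end DWROCA

/-- main counter-bound lemma: every counter value appearing in
the run of a minimal witness is bounded by
`P₃(K) = P₁(K) + 2·((K²·P₂(K))² + 1)` with `P₁(K) = 14K⁶`, `P₂(K) = 6K⁴`
(so `P₃(K) = O(K¹²)`). -/
theorem min_witness_counter_bound {A S : Type} [Field S]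
    (A₁ A₂ : DWROCA A S) (K : ℕ)
    (hK : K = Fintype.card A₁.Q + Fintype.card A₂.Q)
    (w : List A) (hw : IsMinWitness A₁ A₂ w)
    (i : ℕ) (hi : i ≤ w.length) :
    (pairAt A₁ A₂ w i).1.2.1 ≤ 14 * K ^ 6 + 2 * ((K ^ 2 * (6 * K ^ 4)) ^ 2 + 1) ∧
    (pairAt A₁ A₂ w i).2.2.1 ≤ 14 * K ^ 6 + 2 * ((K ^ 2 * (6 * K ^ 4)) ^ 2 + 1) := by
  have hrun := DWROCA.minRun_of_isMinWitness hw
  have hcard : Fintype.card (A₁.sum A₂).Q ≤ K := hK ▸ (Fintype.card_sum).le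
  have hK2 : 2 ≤ K := by
    have h1 : 0 < Fintype.card A₁.Q := Fintype.card_pos_iff.2 ⟨A₁.q0⟩
    have h2 : 0 < Fintype.card A₂.Q := Fintype.card_pos_iff.2 ⟨A₂.q0⟩
    omega
  have hbound : 250 * K ^ 10 + 1 ≤ 14 * K ^ 6 + 2 * ((K ^ 2 * (6 * K ^ 4)) ^ 2 + 1) := by
    have h1 : 2 ^ 2 * K ^ 10 ≤ K ^ 2 * K ^ 10 :=
      Nat.mul_le_mul_right _ (Nat.pow_le_pow_left hK2 2)
    have h2 : (K ^ 2 * (6 * K ^ 4)) ^ 2 = 36 * (K ^ 2 * K ^ 10) := by ring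
    omega
  have h1 := hrun.fst_le_of_le hcard hK2 hi
  have h2 := hrun.symm.fst_le_of_le hcard hK2 hi
  rw [DWROCA.crun_left] at h1
  rw [DWROCA.crun_right] at h2
  exact ⟨h1.trans hbound, h2.trans hbound⟩
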